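/- arXiv:1808.09754 — 2 statements merged into one kernel-verified Lean document; each statement's English description precedes it below -/
import Mathlib

section
/- Let τ > √6 and let ρ_min be a minimizing measure with support M. Let p = (1,0,0), q₁ = (cos θ_max, 0, sin θ_max), q₂ = (cos θ_max, 0, −sin θ_max), and assume M ∩ K(p) ⊆ {q₁, q₂}. Assume further that there exist an open neighborhood V of {q₁, q₂}, a number δ > 0 and finitely many smooth curves c_1, …, c_n : (−δ, δ) → S² parametrized by arc length with c_j(0) ∈ {q₁, q₂} for each j, such that (M ∩ V) ∖ {q₁, q₂} ⊆ c_1((−δ,δ)) ∪ … ∪ c_n((−δ,δ)), and such that no c_j osculates K(p) at c_j(0), i.e. for each j either (d/dt)⟨p, c_j(t)⟩|_{t=0} ≠ 0 or (d²/dt²)⟨p, c_j(t)⟩|_{t=0} ≠ 0. For s ∈ ℝ set p_s = (cos s, sin s, 0), and for r > 0 set U_r = (B_r(q₁) ∪ B_r(q₂)) ∖ {q₁, q₂} (where B_r denotes a geodesic ball of radius r in S²) and I_r(q) = I(q) ∖ U_r. Then there exist constants κ, s₀ > 0 such that for all s, s₁ with |s| ≤ s₁ ≤ s₀, I_{κ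 s₁}(p) ∩ M = I_{κ s₁}(p_s) ∩ M. -/
open MeasureTheory Set
open scoped RealInnerProductSpace ENNReal

noncomputable section

/-- Euclidean three-space. -/
abbrev E3 := EuclideanSpace ℝ (Fin 3)

/-- The unit sphere `S² ⊂ ℝ³`. -/
def Sphere2 : Set E3 := Metric.sphere 0 1

/-- The function `D(x,y) = (1/4)(1+⟨x,y⟩)(2 − τ²(1−⟨x,y⟩))`. -/
def Dfun (τ : ℝ) (x y : E3) : ℝ :=
  (1 / 4) * (1 + ⟪x, y⟫) * (2 - τ ^ 2 * (1 - ⟪x, y⟫))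

/-- The Lagrangian `L = max(0, D)`. -/
def Lfun (τ : ℝ) (x y : E3) : ℝ := max 0 (Dfun τ x y)

/-- The causal action of a measure. -/
def causalAction (τ : ℝ) (ρ : Measure E3) : ℝ :=
  ∫ x, ∫ y, Lfun τ x y ∂ρ ∂ρ

/-- `ρ` is a minimizing measure: a regular Borel probability measure supported on `S²`
minimizing the causal action among all such measures. -/
def IsMinimizer (τ : ℝ) (ρ : Measure E3) : Prop :=
  IsProbabilityMeasure ρ ∧ ρ.Regular ∧ ρ Sphere2ᶜ = 0 ∧
    ∀ ρ' : Measure E3, IsProbabilityMeasure ρ' → ρ'.Regular → ρ' Sphere2ᶜ = 0 →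
      causalAction τ ρ ≤ causalAction τ ρ'

/-- The support of a measure. -/
def msupport (ρ : Measure E3) : Set E3 :=
  {x | ∀ U : Set E3, IsOpen U → x ∈ U → 0 < ρ U}

/-- The opening angle `θ_max = arccos(1 − 2/τ²)`. -/
def θmax (τ : ℝ) : ℝ := Real.arccos (1 - 2 / τ ^ 2)

/-- The open light cone `I(p)`. -/
def lightConeI (τ : ℝ) (p : E3) : Set E3 := {q ∈ Sphere2 | 0 < Dfun τ p q}

/-- The boundary of the light cone `K(p)`. -/
def lightConeK (τ : ℝ) (p : E3) : Set E3 :=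
  {q ∈ Sphere2 | ⟪p, q⟫ = Real.cos (θmax τ)}

/-- Make a point of `ℝ³` from coordinates. -/
def mkE3 (a b c : ℝ) : E3 := (WithLp.equiv 2 (Fin 3 → ℝ)).symm ![a, b, c]

/-- A totally timelike set. -/
def TotallyTimelike (τ : ℝ) (Ω : Set E3) : Prop := ∀ x ∈ Ω, ∀ y ∈ Ω, 0 < Dfun τ x y

/-- `p` is an accumulation point of `A`: every neighborhood of `p` contains a point
of `A` different from `p`. -/
def AccumulationPt (p : E3) (A : Set E3) : Prop :=
  ∀ U ∈ nhds p, ∃ x ∈ A, x ∈ U ∧ x ≠ p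

/-- `γ(0)` is a uniform two-sided accumulation point (of points of `M`) on `γ` of
scaling `β`, where `γ` is defined on `(−δ, δ)`. -/
def UniformTwoSidedAcc (M : Set E3) (β δ : ℝ) (γ : ℝ → E3) : Prop :=
  ∃ ε₀ : ℝ, 0 < ε₀ ∧ ε₀ < δ ∧ ∀ ε : ℝ, 0 < ε → ε ≤ ε₀ →
    (∃ t ∈ Set.Ioo (-ε) (-(ε ^ (1 + β))), γ t ∈ M) ∧
    (∃ t ∈ Set.Ioo (ε ^ (1 + β)) ε, γ t ∈ M)

/-- The point `q₁ = (cos θ_max, 0, sin θ_max)`. -/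
def q1pt (τ : ℝ) : E3 := mkE3 (Real.cos (θmax τ)) 0 (Real.sin (θmax τ))

/-- The point `q₂ = (cos θ_max, 0, −sin θ_max)`. -/
def q2pt (τ : ℝ) : E3 := mkE3 (Real.cos (θmax τ)) 0 (-Real.sin (θmax τ))

/-- The curve `p_s = (cos s, sin s, 0)` along the equator. -/
def pcurve (s : ℝ) : E3 := mkE3 (Real.cos s) (Real.sin s) 0

/-- Geodesic ball in `S²` of radius `r` around `q`. -/
def geoBall (q : E3) (r : ℝ) : Set E3 := {x ∈ Sphere2 | Real.arccos ⟪q, x⟫ < r}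

/-- The set `U_r = (B_r(q₁) ∪ B_r(q₂)) ∖ {q₁, q₂}`. -/
def Uset (τ r : ℝ) : Set E3 := (geoBall (q1pt τ) r ∪ geoBall (q2pt τ) r) \ {q1pt τ, q2pt τ}

/-- The set `I_r(q) = I(q) ∖ U_r`. -/
def Iset (τ r : ℝ) (q : E3) : Set E3 := lightConeI τ q \ Uset τ r

/-- The point of `S²` with latitude `θ` (measured from the equator) and longitude `φ`. -/
def sphPt (θ φ : ℝ) : E3 :=
  mkE3 (Real.cos θ * Real.cos φ) (Real.cos θ * Real.sin φ) (Real.sin θ)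

/-- The restrictions to `Ω` of polynomials of degree at most two on `ℝ³`. -/
def polyRestrictSet (Ω : Set E3) : Set (Ω → ℝ) :=
  {f | ∃ P : MvPolynomial (Fin 3) ℝ, P.totalDegree ≤ 2 ∧
        ∀ x : Ω, f x = MvPolynomial.eval (fun i => (x : E3) i) P}

/-- The space `K(Ω)` of restrictions to `Ω` of polynomials of degree at most two. -/
def KSpace (Ω : Set E3) : Submodule ℝ (Ω → ℝ) := Submodule.span ℝ (polyRestrictSet Ω)

/-- Two-dimensional Hausdorff (surface) measure on `S²` restricted to `Ω`, as a
measure on `Ω`. -/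
def surfΩ (Ω : Set E3) : Measure Ω := Measure.comap Subtype.val (μH[2] : Measure E3)

/-- The bilinear form `B(f,g) = ∫_Ω ∫_Ω D(x,y) f(x) g(y) dμ(x) dμ(y)` on functions on `Ω`. -/
def Bform (τ : ℝ) (Ω : Set E3) (f g : Ω → ℝ) : ℝ :=
  ∫ x, ∫ y, Dfun τ (x : E3) (y : E3) * f x * g y ∂(surfΩ Ω) ∂(surfΩ Ω)

end



lemma aux_lin (a b : ℝ) (h : ∀ t : ℝ, 0 < t → t ≤ 1 → 0 ≤ a * t + b * t ^ 2) : 0 ≤ a := by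
  by_contra hc
  push Not at hc
  have hb : 0 < |b| + 1 := by positivity
  set t := min 1 (-a / (2 * (|b| + 1))) with ht
  have h1 : 0 < -a / (2 * (|b| + 1)) := by apply div_pos <;> linarith
  have ht0 : 0 < t := lt_min one_pos h1
  have ht1 : t ≤ 1 := min_le_left _ _
  have ht2 : t ≤ -a / (2 * (|b| + 1)) := min_le_right _ _
  rw [le_div_iff₀ (by positivity)] at ht2
  have h3 := h t ht0 ht1
  have h4 : b * t ≤ |b| * t := mul_le_mul_of_nonneg_right (le_abs_self b) ht0.le
  have : a + b * t < 0 := by nlinarith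
  nlinarith

lemma int_lin4 (ρ : Measure E3) (a b c d : E3 → ℝ) (α β γ ε : ℝ) (ha : Integrable a ρ)
    (hb : Integrable b ρ) (hc : Integrable c ρ) (hd : Integrable d ρ) :
    ∫ x, (α * a x + β * b x + γ * c x + ε * d x) ∂ρ =
      α * ∫ x, a x ∂ρ + β * ∫ x, b x ∂ρ + γ * ∫ x, c x ∂ρ + ε * ∫ x, d x ∂ρ := by
  have h1 : Integrable (fun x => α * a x + β * b x) ρ := (ha.const_mul α).add (hb.const_mul β)
  have h2 : Integrable (fun x => α * a x + β * b x + γ * c x) ρ := h1.add (hc.const_mul γ)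
  rw [integral_add h2 (hd.const_mul ε), integral_add h1 (hc.const_mul γ),
    integral_add (ha.const_mul α) (hb.const_mul β)]
  simp only [integral_const_mul]

section kern

lemma K_int {K : E3 → E3 → ℝ} (hKc : Continuous (fun z : E3 × E3 => K z.1 z.2))
    (h0 : ∀ x y, 0 ≤ K x y) (h1 : ∀ x y, K x y ≤ 1) (ρ : Measure E3) [IsFiniteMeasure ρ] (x : E3) :
    Integrable (K x) ρ := by
  refine Integrable.of_bound (C := 1) ?_ ?_
  · exact (hKc.comp (by fun_prop : Continuous fun y : E3 => (x, y))).aestronglyMeasurable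
  · filter_upwards with y
    rw [Real.norm_eq_abs, abs_le]; constructor <;> linarith [h0 x y, h1 x y]

lemma ell_cont {K : E3 → E3 → ℝ} (hKc : Continuous (fun z : E3 × E3 => K z.1 z.2))
    (h0 : ∀ x y, 0 ≤ K x y) (h1 : ∀ x y, K x y ≤ 1) (ρ : Measure E3) [IsFiniteMeasure ρ] :
    Continuous (fun x => ∫ y, K x y ∂ρ) := by
  refine continuous_of_dominated (bound := fun _ => 1) ?_ ?_ (integrable_const _) ?_
  · intro x; exact (K_int hKc h0 h1 ρ x).aestronglyMeasurable
  · intro x; filter_upwards with y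
    rw [Real.norm_eq_abs, abs_le]; constructor <;> linarith [h0 x y, h1 x y]
  · filter_upwards with y
    exact hKc.comp (by fun_prop : Continuous fun x : E3 => (x, y))

lemma ell_int {K : E3 → E3 → ℝ} (hKc : Continuous (fun z : E3 × E3 => K z.1 z.2))
    (h0 : ∀ x y, 0 ≤ K x y) (h1 : ∀ x y, K x y ≤ 1) (ρ ν : Measure E3) [IsFiniteMeasure ρ]
    [IsFiniteMeasure ν] :
    Integrable (fun x => ∫ y, K x y ∂ρ) ν := by
  refine Integrable.of_bound (C := ρ.real univ) (ell_cont hKc h0 h1 ρ).aestronglyMeasurable ?_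
  filter_upwards with x
  have h := norm_integral_le_of_norm_le_const (μ := ρ) (f := K x) (C := 1) (by
    filter_upwards with y
    rw [Real.norm_eq_abs, abs_le]; constructor <;> linarith [h0 x y, h1 x y])
  simpa using h

lemma EL1 {K : E3 → E3 → ℝ} (hKc : Continuous (fun z : E3 × E3 => K z.1 z.2))
    (h0 : ∀ x y, 0 ≤ K x y) (h1 : ∀ x y, K x y ≤ 1) (hs : ∀ x y, K x y = K y x)
    (ρ : Measure E3) [IsProbabilityMeasure ρ] (Sp : Set E3) (hSp : IsClosed Sp) (hρ : ρ Spᶜ = 0)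
    (hmin : ∀ ρ' : Measure E3, IsProbabilityMeasure ρ' → ρ' Spᶜ = 0 →
      ∫ x, ∫ y, K x y ∂ρ ∂ρ ≤ ∫ x, ∫ y, K x y ∂ρ' ∂ρ') (x : E3) (hx : x ∈ Sp) :
    ∫ x, ∫ y, K x y ∂ρ ∂ρ ≤ ∫ y, K x y ∂ρ := by
  set S := ∫ x, ∫ y, K x y ∂ρ ∂ρ with hS
  set l := ∫ y, K x y ∂ρ with hl
  suffices h : 0 ≤ 2 * (l - S) by linarith
  apply aux_lin _ (S - 2 * l + K x x)
  intro t ht0 ht1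
  set ρ' : Measure E3 := ENNReal.ofReal (1 - t) • ρ + ENNReal.ofReal t • Measure.dirac x with hρ'
  have hp : IsProbabilityMeasure ρ' := by
    constructor
    simp only [hρ', Measure.add_apply, Measure.smul_apply, measure_univ, smul_eq_mul, mul_one]
    rw [← ENNReal.ofReal_add (by linarith) ht0.le]; simp
  have hn : ρ' Spᶜ = 0 := by
    simp only [hρ', Measure.add_apply, Measure.smul_apply, hρ, smul_eq_mul, mul_zero, zero_add]
    rw [Measure.dirac_apply' _ hSp.measurableSet.compl]
    simp [hx]
  have hi : ∀ g : E3 → ℝ, Continuous g → Integrable g ρ →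
      ∫ y, g y ∂ρ' = (1 - t) * ∫ y, g y ∂ρ + t * g x := by
    intro g hg hgi
    have hd : Integrable g (Measure.dirac x) := integrable_dirac (by simp)
    rw [hρ', integral_add_measure (hgi.smul_measure (by simp)) (hd.smul_measure (by simp)),
      integral_smul_measure, integral_smul_measure, integral_dirac,
      ENNReal.toReal_ofReal (by linarith), ENNReal.toReal_ofReal ht0.le]
    simp
  have hm := hmin ρ' hp hn
  have e1 : ∀ z, ∫ y, K z y ∂ρ' = (1 - t) * ∫ y, K z y ∂ρ + t * K z x := fun z =>
    hi _ (hKc.comp (by fun_prop : Continuous fun y : E3 => (z, y))) (K_int hKc h0 h1 ρ z)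
  simp_rw [e1] at hm
  have e2 : (fun z => K z x) = K x := by funext z; exact hs z x
  have i1 := ell_int hKc h0 h1 ρ ρ
  have i2 : Integrable (fun z => K z x) ρ := by rw [e2]; exact K_int hKc h0 h1 ρ x
  have c1 : Continuous (fun z => (1 - t) * (∫ y, K z y ∂ρ) + t * K z x) :=
    ((ell_cont hKc h0 h1 ρ).const_mul _).add
      ((hKc.comp (by fun_prop : Continuous fun z : E3 => (z, x))).const_mul _)
  have c2 : Integrable (fun z => (1 - t) * (∫ y, K z y ∂ρ) + t * K z x) ρ :=
    (i1.const_mul _).add (i2.const_mul _)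
  rw [hi _ c1 c2, integral_add (i1.const_mul _) (i2.const_mul _),
    integral_const_mul, integral_const_mul, e2, ← hl, ← hS] at hm
  nlinarith

lemma msupport_null (ρ : Measure E3) : ρ (msupport ρ)ᶜ = 0 := by
  apply measure_null_of_locally_null
  intro x hx
  simp only [msupport, mem_compl_iff, Set.mem_ofPred_eq, not_forall, not_lt, nonpos_iff_eq_zero] at hx
  obtain ⟨U, hU, hxU, h⟩ := hx
  exact ⟨U, mem_nhdsWithin_of_mem_nhds (hU.mem_nhds hxU), h⟩

lemma msupport_ae (ρ : Measure E3) : ∀ᵐ y ∂ρ, y ∈ msupport ρ := msupport_null ρ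

lemma EL2 {K : E3 → E3 → ℝ} (hKc : Continuous (fun z : E3 × E3 => K z.1 z.2))
    (h0 : ∀ x y, 0 ≤ K x y) (h1 : ∀ x y, K x y ≤ 1) (hs : ∀ x y, K x y = K y x)
    (ρ : Measure E3) [IsProbabilityMeasure ρ] (Sp : Set E3) (hSp : IsClosed Sp) (hρ : ρ Spᶜ = 0)
    (hmin : ∀ ρ' : Measure E3, IsProbabilityMeasure ρ' → ρ' Spᶜ = 0 →
      ∫ x, ∫ y, K x y ∂ρ ∂ρ ≤ ∫ x, ∫ y, K x y ∂ρ' ∂ρ') (x : E3) (hx : x ∈ msupport ρ) :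
    ∫ y, K x y ∂ρ = ∫ x, ∫ y, K x y ∂ρ ∂ρ := by
  set S := ∫ x, ∫ y, K x y ∂ρ ∂ρ with hS
  have hc := ell_cont hKc h0 h1 ρ
  have i1 := ell_int hKc h0 h1 ρ ρ
  have hae : ∀ᵐ z ∂ρ, 0 ≤ (∫ y, K z y ∂ρ) - S := by
    have : ∀ᵐ z ∂ρ, z ∈ Sp := hρ
    filter_upwards [this] with z hz
    linarith [EL1 hKc h0 h1 hs ρ Sp hSp hρ hmin z hz]
  have hz : ∫ z, ((∫ y, K z y ∂ρ) - S) ∂ρ = 0 := by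
    rw [integral_sub i1 (integrable_const _)]; simp [← hS]
  have h2 := (integral_eq_zero_iff_of_nonneg_ae hae (i1.sub (integrable_const _))).1 hz
  by_contra hne
  have hU : IsOpen {z | (∫ y, K z y ∂ρ) ≠ S} := isOpen_ne_fun hc continuous_const
  have h3 := hx _ hU hne
  have h4 : ρ {z | (∫ y, K z y ∂ρ) ≠ S} = 0 := by
    have : ∀ᵐ z ∂ρ, (∫ y, K z y ∂ρ) = S := by
      filter_upwards [h2] with z hz
      simp at hz; linarith
    exact this
  exact h3.ne' h4

/-- second variation, for bounded densities -/
lemma SV {K : E3 → E3 → ℝ} (hKc : Continuous (fun z : E3 × E3 => K z.1 z.2))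
    (h0 : ∀ x y, 0 ≤ K x y) (h1 : ∀ x y, K x y ≤ 1) (hs : ∀ x y, K x y = K y x)
    (ρ : Measure E3) [IsProbabilityMeasure ρ] (Sp : Set E3) (hSp : IsClosed Sp) (hρ : ρ Spᶜ = 0)
    (hmin : ∀ ρ' : Measure E3, IsProbabilityMeasure ρ' → ρ' Spᶜ = 0 →
      ∫ x, ∫ y, K x y ∂ρ ∂ρ ≤ ∫ x, ∫ y, K x y ∂ρ' ∂ρ')
    (f : E3 → ℝ) (hf : Measurable f) (B : ℝ) (hB : ∀ x, |f x| ≤ B) :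
    0 ≤ ∫ x, f x * ∫ y, f y * K x y ∂ρ ∂ρ := by
  set S := ∫ x, ∫ y, K x y ∂ρ ∂ρ with hS
  have hKx : ∀ x, Measurable (K x) := fun x =>
    (hKc.comp (by fun_prop : Continuous fun y : E3 => (x, y))).measurable
  have hS0 : 0 ≤ S := integral_nonneg fun x => integral_nonneg fun y => h0 x y
  -- integrability helper
  have bint : ∀ (g : E3 → ℝ) (C : ℝ), Measurable g → (∀ x, |g x| ≤ C) → Integrable g ρ := by
    intro g C hg hC
    exact Integrable.of_bound (C := C) hg.aestronglyMeasurable (by filter_upwards with y; exact hC y)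
  have habsK : ∀ x y, |K x y| ≤ 1 := fun x y => by
    rw [abs_le]; constructor <;> linarith [h0 x y, h1 x y]
  -- T g
  have mT : ∀ g : E3 → ℝ, Measurable g → Measurable (fun x => ∫ y, g y * K x y ∂ρ) := by
    intro g hg
    have : StronglyMeasurable (Function.uncurry fun x y => g y * K x y) := by
      apply Measurable.stronglyMeasurable
      exact (hg.comp measurable_snd).mul hKc.measurable
    exact (this.integral_prod_right (ν := ρ)).measurable
  have bT : ∀ (g : E3 → ℝ) (C : ℝ), (∀ x, |g x| ≤ C) → ∀ x, |∫ y, g y * K x y ∂ρ| ≤ C := by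
    intro g C hC x
    have h := norm_integral_le_of_norm_le_const (μ := ρ) (f := fun y => g y * K x y) (C := C) (by
      filter_upwards with y
      rw [Real.norm_eq_abs, abs_mul]
      have := hC y
      have h2 := habsK x y
      nlinarith [abs_nonneg (g y), abs_nonneg (K x y)])
    simpa using h
  have i1 := ell_int hKc h0 h1 ρ ρ
  have mell := (ell_cont hKc h0 h1 ρ).measurable
  have bell : ∀ x, |∫ y, K x y ∂ρ| ≤ 1 := fun x => by
    have := bT (fun _ => 1) 1 (by simp) x
    simpa using this
  have i2 : ∀ (g : E3 → ℝ) (C : ℝ), Measurable g → (∀ x, |g x| ≤ C) →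
      Integrable (fun x => ∫ y, g y * K x y ∂ρ) ρ := fun g C hg hC => bint _ C (mT g hg) (bT g C hC)
  have i3 : ∀ (g : E3 → ℝ) (C : ℝ), Measurable g → (∀ x, |g x| ≤ C) →
      Integrable (fun x => g x * ∫ y, K x y ∂ρ) ρ := fun g C hg hC =>
    bint _ (C * 1) (hg.mul mell) (fun y => by
      rw [abs_mul]
      exact mul_le_mul (hC y) (bell y) (abs_nonneg _) ((abs_nonneg _).trans (hC 0)))
  have i4 : ∀ (g : E3 → ℝ) (C : ℝ), Measurable g → (∀ x, |g x| ≤ C) →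
      Integrable (fun x => g x * ∫ y, g y * K x y ∂ρ) ρ := fun g C hg hC =>
    bint _ (C * C) (hg.mul (mT g hg)) (fun y => by
      rw [abs_mul]
      exact mul_le_mul (hC y) (bT g C hC y) (abs_nonneg _) ((abs_nonneg _).trans (hC 0)))
  have v3 : ∀ (g : E3 → ℝ) (C : ℝ), Measurable g → (∀ x, |g x| ≤ C) →
      ∫ x, g x * ∫ y, K x y ∂ρ ∂ρ = (∫ x, g x ∂ρ) * S := by
    intro g C hg hC
    have : ∫ x, g x * ∫ y, K x y ∂ρ ∂ρ = ∫ x, g x * S ∂ρ := by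
      refine integral_congr_ae ?_
      filter_upwards [msupport_ae ρ] with x hx
      simp only [EL2 hKc h0 h1 hs ρ Sp hSp hρ hmin x hx, ← hS]
    rw [this, integral_mul_const]
  have v2 : ∀ (g : E3 → ℝ) (C : ℝ), Measurable g → (∀ x, |g x| ≤ C) →
      ∫ x, ∫ y, g y * K x y ∂ρ ∂ρ = (∫ x, g x ∂ρ) * S := by
    intro g C hg hC
    rw [integral_integral_swap]
    · rw [← v3 g C hg hC]
      congr 1; funext y
      rw [integral_const_mul]
      congr 2; funext x; exact hs x y
    · refine Integrable.of_bound (C := C * 1) ?_ ?_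
      · exact ((hg.comp measurable_snd).mul hKc.measurable).aestronglyMeasurable
      · filter_upwards with z
        simp only [Function.uncurry, Real.norm_eq_abs, abs_mul]
        exact mul_le_mul (hC _) (habsK _ _) (abs_nonneg _) ((abs_nonneg _).trans (hC 0))
  -- key : zero-mean case
  have key : ∀ (g : E3 → ℝ) (C : ℝ), Measurable g → (∀ x, |g x| ≤ C) → ∫ x, g x ∂ρ = 0 →
      0 ≤ ∫ x, g x * ∫ y, g y * K x y ∂ρ ∂ρ := by
    intro g C hg hC hg0
    have hCn : 0 ≤ C := (abs_nonneg _).trans (hC 0)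
    set t : ℝ := 1 / (C + 1) with ht
    have ht0 : 0 < t := by positivity
    have htC : t * C ≤ 1 := by rw [ht, div_mul_eq_mul_div, div_le_one (by positivity)]; linarith
    have hpos : ∀ x, 0 ≤ 1 + t * g x := by
      intro x
      have := (abs_le.1 (hC x)).1
      nlinarith
    set φ : E3 → NNReal := fun x => Real.toNNReal (1 + t * g x) with hφ
    have hφm : Measurable φ := (measurable_const.add (hg.const_mul t)).real_toNNReal
    set ρ' : Measure E3 := ρ.withDensity (fun x => (φ x : ℝ≥0∞)) with hρ'
    have hI : ∀ h : E3 → ℝ, ∫ x, h x ∂ρ' = ∫ x, (1 + t * g x) * h x ∂ρ := by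
      intro h
      rw [hρ', integral_withDensity_eq_integral_smul hφm]
      refine integral_congr_ae ?_
      filter_upwards with x
      simp only [NNReal.smul_def, smul_eq_mul, hφ, Real.coe_toNNReal _ (hpos x)]
    have gi := bint g C hg hC
    have hp : IsProbabilityMeasure ρ' := by
      constructor
      rw [hρ', withDensity_apply _ MeasurableSet.univ, Measure.restrict_univ]
      have : ∀ x, (φ x : ℝ≥0∞) = ENNReal.ofReal (1 + t * g x) := fun x => rfl
      simp_rw [this]
      have gi2 : Integrable (fun x => 1 + t * g x) ρ := (integrable_const _).add (gi.const_mul t)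
      rw [← ofReal_integral_eq_lintegral_ofReal gi2
        (by filter_upwards with x using hpos x)]
      rw [integral_add (integrable_const _) (gi.const_mul t), integral_const_mul, hg0]
      simp
    have hn : ρ' Spᶜ = 0 := withDensity_absolutelyContinuous _ _ hρ
    have hm := hmin ρ' hp hn
    rw [hI] at hm
    have iK : ∀ x, Integrable (K x) ρ := K_int hKc h0 h1 ρ
    have igK : ∀ x, Integrable (fun y => g y * K x y) ρ := fun x =>
      bint _ (C * 1) (hg.mul (hKx x)) (fun y => by
        rw [abs_mul]; exact mul_le_mul (hC y) (habsK x y) (abs_nonneg _) hCn)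
    have e1 : ∀ x, ∫ y, K x y ∂ρ' = (∫ y, K x y ∂ρ) + t * ∫ y, g y * K x y ∂ρ := by
      intro x
      rw [hI, ← integral_const_mul, ← integral_add (iK x) ((igK x).const_mul t)]
      congr 1; funext y; ring
    simp_rw [e1] at hm
    have e2 : ∫ x, (1 + t * g x) * ((∫ y, K x y ∂ρ) + t * ∫ y, g y * K x y ∂ρ) ∂ρ
        = 1 * S + t * 0 + t * 0 + t ^ 2 * ∫ x, g x * ∫ y, g y * K x y ∂ρ ∂ρ := by
      have := int_lin4 ρ _ _ _ _ 1 t t (t ^ 2) i1 (i2 g C hg hC) (i3 g C hg hC) (i4 g C hg hC)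
      rw [v2 g C hg hC, v3 g C hg hC, hg0, zero_mul] at this
      rw [← this]
      congr 1; funext x
      ring
    rw [e2] at hm
    have : 0 ≤ t ^ 2 * ∫ x, g x * ∫ y, g y * K x y ∂ρ ∂ρ := by linarith
    exact nonneg_of_mul_nonneg_right this (by positivity)
  set m := ∫ x, f x ∂ρ with hm
  have fi := bint f B hf hB
  have hmB : |m| ≤ B := by
    have h := norm_integral_le_of_norm_le_const (μ := ρ) (f := f) (C := B)
      (by filter_upwards with y using hB y)
    simpa using h
  have hk := key (fun x => f x - m) (B + B) (hf.sub_const m)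
    (fun x => (abs_sub _ _).trans (add_le_add (hB x) hmB))
    (by rw [integral_sub fi (integrable_const _)]; simp [hm])
  have e1 : ∀ x, ∫ y, (f y - m) * K x y ∂ρ = (∫ y, f y * K x y ∂ρ) - m * ∫ y, K x y ∂ρ := by
    intro x
    have ifK : Integrable (fun y => f y * K x y) ρ :=
      bint _ (B * 1) (hf.mul (hKx x)) (fun y => by
        rw [abs_mul]
        exact mul_le_mul (hB y) (habsK x y) (abs_nonneg _) ((abs_nonneg _).trans (hB 0)))
    rw [← integral_const_mul, ← integral_sub ifK ((K_int hKc h0 h1 ρ x).const_mul m)]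
    congr 1; funext y; ring
  simp_rw [e1] at hk
  have e2 : ∫ x, (f x - m) * ((∫ y, f y * K x y ∂ρ) - m * ∫ y, K x y ∂ρ) ∂ρ
      = m ^ 2 * S + (-m) * (m * S) + (-m) * (m * S) + 1 * ∫ x, f x * ∫ y, f y * K x y ∂ρ ∂ρ := by
    have := int_lin4 ρ _ _ _ _ (m ^ 2) (-m) (-m) 1 i1 (i2 f B hf hB) (i3 f B hf hB) (i4 f B hf hB)
    rw [v2 f B hf hB, v3 f B hf hB] at this
    rw [← hm] at this
    rw [hS, ← this]
    congr 1; funext x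
    ring
  rw [e2] at hk
  nlinarith [mul_nonneg (sq_nonneg m) hS0]
end kern


lemma avg_close (ρ : Measure E3) (φ h : E3 → ℝ) (κ ε : ℝ) (hφ0 : ∀ x, 0 ≤ φ x)
    (hφi : Integrable φ ρ) (hφ1 : ∫ x, φ x ∂ρ = 1) (hi : Integrable (fun x => φ x * h x) ρ)
    (hh : ∀ x, φ x ≠ 0 → |h x - κ| ≤ ε) : |(∫ x, φ x * h x ∂ρ) - κ| ≤ ε := by
  have e : (∫ x, φ x * h x ∂ρ) - κ = ∫ x, (φ x * h x - φ x * κ) ∂ρ := by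
    rw [integral_sub hi (hφi.mul_const κ), integral_mul_const, hφ1, one_mul]
  rw [e]
  have h2 : ∫ x, φ x * ε ∂ρ = ε := by rw [integral_mul_const, hφ1, one_mul]
  rw [← h2]
  refine norm_integral_le_of_norm_le (f := fun x => φ x * h x - φ x * κ) (hφi.mul_const ε) ?_
  filter_upwards with x
  rw [Real.norm_eq_abs, ← mul_sub, abs_mul, abs_of_nonneg (hφ0 x)]
  by_cases hx : φ x = 0
  · simp [hx]
  · exact mul_le_mul_of_nonneg_left (hh x hx) (hφ0 x)

lemma PSD {K : E3 → E3 → ℝ} (hKc : Continuous (fun z : E3 × E3 => K z.1 z.2))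
    (h0 : ∀ x y, 0 ≤ K x y) (h1 : ∀ x y, K x y ≤ 1) (hs : ∀ x y, K x y = K y x)
    (ρ : Measure E3) [IsProbabilityMeasure ρ] (Sp : Set E3) (hSp : IsClosed Sp) (hρ : ρ Spᶜ = 0)
    (hmin : ∀ ρ' : Measure E3, IsProbabilityMeasure ρ' → ρ' Spᶜ = 0 →
      ∫ x, ∫ y, K x y ∂ρ ∂ρ ≤ ∫ x, ∫ y, K x y ∂ρ' ∂ρ')
    (s : Finset E3) (hsM : ∀ x ∈ s, x ∈ msupport ρ) (c : E3 → ℝ) :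
    0 ≤ ∑ i ∈ s, ∑ j ∈ s, c i * c j * K i j := by
  suffices H : ∀ ε > 0, -(ε * ∑ i ∈ s, ∑ j ∈ s, |c i * c j|) ≤ ∑ i ∈ s, ∑ j ∈ s, c i * c j * K i j by
    set W := ∑ i ∈ s, ∑ j ∈ s, |c i * c j| with hW
    have hW0 : 0 ≤ W := Finset.sum_nonneg fun i _ => Finset.sum_nonneg fun j _ => abs_nonneg _
    by_contra hc
    push Not at hc
    set Q := ∑ i ∈ s, ∑ j ∈ s, c i * c j * K i j with hQ
    have h := H (-Q / (2 * (W + 1))) (by apply div_pos <;> linarith)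
    have : -Q / (2 * (W + 1)) * W ≤ -Q / 2 := by
      rw [div_mul_eq_mul_div, div_le_div_iff₀ (by positivity) (by norm_num)]
      nlinarith
    linarith
  intro ε hε
  -- radius
  have hr : ∃ r > 0, ∀ i ∈ s, ∀ j ∈ s, ∀ x ∈ Metric.ball i r, ∀ y ∈ Metric.ball j r,
      |K x y - K i j| ≤ ε := by
    have h : ∀ i j : E3, ∃ r > 0, ∀ x ∈ Metric.ball i r, ∀ y ∈ Metric.ball j r,
        |K x y - K i j| ≤ ε := by
      intro i j
      obtain ⟨r, hr, h⟩ := Metric.continuousAt_iff.1 (hKc.continuousAt (x := (i, j))) ε hε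
      refine ⟨r, hr, fun x hx y hy => ?_⟩
      have := h (x := (x, y)) (by rw [Prod.dist_eq]; exact max_lt hx hy)
      rw [Real.dist_eq] at this
      exact this.le
    choose R hR hR2 using h
    rcases s.eq_empty_or_nonempty with he | hne
    · exact ⟨1, one_pos, by simp [he]⟩
    · refine ⟨(s ×ˢ s).inf' (hne.product hne) (fun p => R p.1 p.2), ?_, ?_⟩
      · rw [gt_iff_lt, Finset.lt_inf'_iff]; intro p _; exact hR _ _
      · intro i hi j hj x hx y hy
        have hle : (s ×ˢ s).inf' (hne.product hne) (fun p => R p.1 p.2) ≤ R i j :=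
          Finset.inf'_le (fun p : E3 × E3 => R p.1 p.2) (b := (i, j)) (Finset.mem_product.2 ⟨hi, hj⟩)
        exact hR2 i j x (Metric.ball_subset_ball hle hx) y (Metric.ball_subset_ball hle hy)
  obtain ⟨r, hr0, hr⟩ := hr
  set φ : E3 → E3 → ℝ := fun i => (Metric.ball i r).indicator (fun _ => (ρ.real (Metric.ball i r))⁻¹) with hφ
  have hφm : ∀ i, Measurable (φ i) := fun i => measurable_const.indicator Metric.isOpen_ball.measurableSet
  have hφ0 : ∀ i x, 0 ≤ φ i x := fun i x => indicator_nonneg (fun _ _ => by positivity) x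
  have hφb : ∀ i x, |φ i x| ≤ (ρ.real (Metric.ball i r))⁻¹ := fun i x => by
    rw [abs_of_nonneg (hφ0 i x)]
    exact indicator_le_self' (fun _ _ => by positivity) x
  have bint : ∀ (g : E3 → ℝ) (C : ℝ), Measurable g → (∀ x, |g x| ≤ C) → Integrable g ρ := by
    intro g C hg hC
    exact Integrable.of_bound (C := C) hg.aestronglyMeasurable (by filter_upwards with y; exact hC y)
  have habsK : ∀ x y, |K x y| ≤ 1 := fun x y => by
    rw [abs_le]; constructor <;> linarith [h0 x y, h1 x y]
  have hφi : ∀ i, Integrable (φ i) ρ := fun i => bint _ _ (hφm i) (hφb i)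
  have hφ1 : ∀ i ∈ s, ∫ x, φ i x ∂ρ = 1 := by
    intro i hi
    rw [hφ]
    simp only
    rw [integral_indicator_const _ Metric.isOpen_ball.measurableSet, smul_eq_mul]
    apply mul_inv_cancel₀
    have := hsM i hi _ Metric.isOpen_ball (Metric.mem_ball_self hr0)
    exact (ENNReal.toReal_pos this.ne' (measure_ne_top _ _)).ne'
  have hKx : ∀ x, Measurable (K x) := fun x =>
    (hKc.comp (by fun_prop : Continuous fun y : E3 => (x, y))).measurable
  have mT : ∀ g : E3 → ℝ, Measurable g → Measurable (fun x => ∫ y, g y * K x y ∂ρ) := by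
    intro g hg
    have : StronglyMeasurable (Function.uncurry fun x y => g y * K x y) := by
      apply Measurable.stronglyMeasurable
      exact (hg.comp measurable_snd).mul hKc.measurable
    exact (this.integral_prod_right (ν := ρ)).measurable
  have bT : ∀ (g : E3 → ℝ) (C : ℝ), (∀ x, |g x| ≤ C) → ∀ x, |∫ y, g y * K x y ∂ρ| ≤ C := by
    intro g C hC x
    have h := norm_integral_le_of_norm_le_const (μ := ρ) (f := fun y => g y * K x y) (C := C) (by
      filter_upwards with y
      rw [Real.norm_eq_abs, abs_mul]
      have := hC y
      have h2 := habsK x y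
      nlinarith [abs_nonneg (g y), abs_nonneg (K x y)])
    simpa using h
  have iφK : ∀ j x, Integrable (fun y => φ j y * K x y) ρ := fun j x =>
    bint _ ((ρ.real (Metric.ball j r))⁻¹ * 1) ((hφm j).mul (hKx x)) (fun y => by
      rw [abs_mul]; exact mul_le_mul (hφb j y) (habsK x y) (abs_nonneg _) (by positivity))
  have iφφ : ∀ i j, Integrable (fun x => φ i x * ∫ y, φ j y * K x y ∂ρ) ρ := fun i j =>
    bint _ ((ρ.real (Metric.ball i r))⁻¹ * (ρ.real (Metric.ball j r))⁻¹) ((hφm i).mul (mT _ (hφm j)))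
      (fun y => by
        rw [abs_mul]
        exact mul_le_mul (hφb i y) (bT _ _ (hφb j) y) (abs_nonneg _) (by positivity))
  have hball : ∀ i x, φ i x ≠ 0 → x ∈ Metric.ball i r := fun i x hx =>
    by_contra fun h => hx (indicator_of_notMem h _)
  have hA : ∀ i ∈ s, ∀ j ∈ s, |(∫ x, φ i x * ∫ y, φ j y * K x y ∂ρ ∂ρ) - K i j| ≤ ε := by
    intro i hi j hj
    refine avg_close ρ (φ i) _ _ _ (hφ0 i) (hφi i) (hφ1 i hi) (iφφ i j) fun x hx => ?_
    refine avg_close ρ (φ j) _ _ _ (hφ0 j) (hφi j) (hφ1 j hj) (iφK j x) fun y hy => ?_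
    exact hr i hi j hj x (hball i x hx) y (hball j y hy)
  have hsv := SV hKc h0 h1 hs ρ Sp hSp hρ hmin (fun x => ∑ i ∈ s, c i * φ i x)
    (Finset.measurable_sum s fun i _ => (hφm i).const_mul (c i))
    (∑ i ∈ s, |c i| * (ρ.real (Metric.ball i r))⁻¹) (fun x => by
      refine (Finset.abs_sum_le_sum_abs _ _).trans (Finset.sum_le_sum fun i _ => ?_)
      rw [abs_mul]; exact mul_le_mul_of_nonneg_left (hφb i x) (abs_nonneg _))
  have e1 : ∀ x, ∫ y, (∑ i ∈ s, c i * φ i y) * K x y ∂ρ = ∑ j ∈ s, c j * ∫ y, φ j y * K x y ∂ρ := by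
    intro x
    simp_rw [Finset.sum_mul]
    rw [integral_finsetSum]
    · refine Finset.sum_congr rfl fun j _ => ?_
      rw [← integral_const_mul]; congr 1; funext y; ring
    · intro j _
      have := (iφK j x).const_mul (c j)
      refine this.congr ?_
      filter_upwards with y; ring
  simp_rw [e1] at hsv
  have e2 : ∫ x, (∑ i ∈ s, c i * φ i x) * (∑ j ∈ s, c j * ∫ y, φ j y * K x y ∂ρ) ∂ρ
      = ∑ i ∈ s, ∑ j ∈ s, c i * c j * ∫ x, φ i x * ∫ y, φ j y * K x y ∂ρ ∂ρ := by
    have hii : ∀ i j, Integrable (fun x => c i * φ i x * (c j * ∫ y, φ j y * K x y ∂ρ)) ρ := by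
      intro i j
      refine ((iφφ i j).const_mul (c i * c j)).congr ?_
      filter_upwards with y; ring
    simp_rw [Finset.sum_mul_sum]
    rw [integral_finsetSum]
    · refine Finset.sum_congr rfl fun i _ => ?_
      rw [integral_finsetSum]
      · refine Finset.sum_congr rfl fun j _ => ?_
        rw [← integral_const_mul]; congr 1; funext y; ring
      · intro j _; exact hii i j
    · intro i _; exact integrable_finsetSum _ fun j _ => hii i j
  rw [e2] at hsv
  have h3 : ∑ i ∈ s, ∑ j ∈ s, c i * c j * (∫ x, φ i x * ∫ y, φ j y * K x y ∂ρ ∂ρ) ≤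
      ∑ i ∈ s, ∑ j ∈ s, (c i * c j * K i j + ε * |c i * c j|) := by
    refine Finset.sum_le_sum fun i hi => Finset.sum_le_sum fun j hj => ?_
    have h := hA i hi j hj
    have h4 : c i * c j * ((∫ x, φ i x * ∫ y, φ j y * K x y ∂ρ ∂ρ) - K i j) ≤ |c i * c j| * ε := by
      refine (le_abs_self _).trans ?_
      rw [abs_mul]; exact mul_le_mul_of_nonneg_left h (abs_nonneg _)
    linarith
  simp_rw [Finset.sum_add_distrib, ← Finset.mul_sum] at h3
  linarith

lemma PSD0 {K : E3 → E3 → ℝ} (hs : ∀ x y, K x y = K y x) (s : Finset E3)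
    (hpsd : ∀ c : E3 → ℝ, 0 ≤ ∑ i ∈ s, ∑ j ∈ s, c i * c j * K i j) (c : E3 → ℝ)
    (hc : ∑ i ∈ s, ∑ j ∈ s, c i * c j * K i j = 0) (y : E3) (hy : y ∈ s) :
    ∑ i ∈ s, c i * K i y = 0 := by
  classical
  set b := ∑ i ∈ s, c i * K i y with hb
  have key : ∀ t : ℝ, 0 ≤ 2 * t * b + t ^ 2 * K y y := by
    intro t
    have h := hpsd (fun i => c i + if i = y then t else 0)
    have e : ∑ i ∈ s, ∑ j ∈ s, (c i + if i = y then t else 0) * (c j + if j = y then t else 0) * K i j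
        = 2 * t * b + t ^ 2 * K y y := by
      have : ∀ i j, (c i + if i = y then t else 0) * (c j + if j = y then t else 0) * K i j
          = c i * c j * K i j + (if i = y then t * (c j * K i j) else 0)
            + (if j = y then t * (c i * K i j) else 0)
            + (if i = y then (if j = y then t ^ 2 * K i j else 0) else 0) := by
        intro i j; split_ifs <;> ring
      simp_rw [this, Finset.sum_add_distrib]
      rw [hc]
      have e1 : ∑ i ∈ s, ∑ j ∈ s, (if i = y then t * (c j * K i j) else 0) = t * b := by
        rw [Finset.sum_comm]
        simp_rw [Finset.sum_ite_eq' s y, if_pos hy]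
        rw [← Finset.mul_sum, hb]
        congr 1; refine Finset.sum_congr rfl fun i _ => by rw [hs]
      have e2 : ∑ i ∈ s, ∑ j ∈ s, (if j = y then t * (c i * K i j) else 0) = t * b := by
        simp_rw [Finset.sum_ite_eq' s y, if_pos hy]
        rw [← Finset.mul_sum, hb]
      have e3 : ∑ i ∈ s, ∑ j ∈ s, (if i = y then (if j = y then t ^ 2 * K i j else 0) else 0)
          = t ^ 2 * K y y := by
        rw [Finset.sum_comm]
        simp_rw [Finset.sum_ite_eq' s y, if_pos hy]
        rw [Finset.sum_ite_eq' s y, if_pos hy]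
      rw [e1, e2, e3]; ring
    rw [e] at h; exact h
  have h1 : 0 ≤ 2 * b := aux_lin _ (K y y) fun t _ _ => by linarith [key t]
  have h2 : 0 ≤ -(2 * b) := aux_lin _ (K y y) fun t _ _ => by have := key (-t); nlinarith
  linarith


noncomputable def Kf (τ : ℝ) (x y : E3) : ℝ := min (Lfun τ x y) 1

lemma Dfun_cont (τ : ℝ) : Continuous (fun z : E3 × E3 => Dfun τ z.1 z.2) := by
  unfold Dfun; fun_prop

lemma Kf_cont (τ : ℝ) : Continuous (fun z : E3 × E3 => Kf τ z.1 z.2) :=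
  (continuous_const.max (Dfun_cont τ)).min continuous_const

lemma Kf_nonneg (τ : ℝ) (x y : E3) : 0 ≤ Kf τ x y := le_min (le_max_left _ _) zero_le_one
lemma Kf_le (τ : ℝ) (x y : E3) : Kf τ x y ≤ 1 := min_le_right _ _
lemma Dfun_symm (τ : ℝ) (x y : E3) : Dfun τ x y = Dfun τ y x := by
  unfold Dfun; rw [real_inner_comm]
lemma Kf_symm (τ : ℝ) (x y : E3) : Kf τ x y = Kf τ y x := by
  unfold Kf Lfun; rw [Dfun_symm]

lemma sph_norm {x : E3} (hx : x ∈ Sphere2) : ‖x‖ = 1 := by simpa [Sphere2] using hx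

lemma sph_le {x y : E3} (hx : x ∈ Sphere2) (hy : y ∈ Sphere2) : ⟪x, y⟫ ≤ 1 := by
  have := real_inner_le_norm x y
  rwa [sph_norm hx, sph_norm hy, one_mul] at this

lemma sph_ge {x y : E3} (hx : x ∈ Sphere2) (hy : y ∈ Sphere2) : -1 ≤ ⟪x, y⟫ := by
  have := neg_le_of_abs_le (abs_real_inner_le_norm x y)
  rwa [sph_norm hx, sph_norm hy, one_mul] at this

lemma Dfun_eq {τ : ℝ} (hT : 6 < τ ^ 2) (x y : E3) :
    Dfun τ x y = (1 / 4) * (1 + ⟪x, y⟫) * (τ ^ 2 * (⟪x, y⟫ - (1 - 2 / τ ^ 2))) := by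
  unfold Dfun
  have : τ ^ 2 ≠ 0 := by positivity
  have h : τ ^ 2 * (2 / τ ^ 2) = 2 := mul_div_cancel₀ 2 this
  linear_combination (-(1 / 4) * (1 + ⟪x, y⟫)) * h

lemma Kf_eq {τ : ℝ} {x y : E3} (hx : x ∈ Sphere2) (hy : y ∈ Sphere2) :
    Kf τ x y = max 0 (Dfun τ x y) := by
  unfold Kf Lfun
  apply min_eq_left
  apply max_le zero_le_one
  unfold Dfun
  have h1 := sph_le hx hy
  have h2 := sph_ge hx hy
  by_cases h : 2 - τ ^ 2 * (1 - ⟪x, y⟫) ≤ 0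
  · nlinarith
  · push Not at h
    nlinarith [mul_nonneg (sq_nonneg τ) (sub_nonneg.2 h1)]

lemma Kf_pos_case {τ : ℝ} (hT : 6 < τ ^ 2) {x y : E3} (hx : x ∈ Sphere2) (hy : y ∈ Sphere2)
    (h : 1 - 2 / τ ^ 2 ≤ ⟪x, y⟫) : Kf τ x y = Dfun τ x y := by
  rw [Kf_eq hx hy]
  apply max_eq_right
  rw [Dfun_eq hT]
  have h2 := sph_ge hx hy
  have : 0 ≤ τ ^ 2 * (⟪x, y⟫ - (1 - 2 / τ ^ 2)) := mul_nonneg (by positivity) (by linarith)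
  nlinarith

lemma Kf_neg_case {τ : ℝ} (hT : 6 < τ ^ 2) {x y : E3} (hx : x ∈ Sphere2) (hy : y ∈ Sphere2)
    (h : ⟪x, y⟫ ≤ 1 - 2 / τ ^ 2) : Kf τ x y = 0 := by
  rw [Kf_eq hx hy]
  apply max_eq_left
  rw [Dfun_eq hT]
  have h2 := sph_ge hx hy
  have : 0 ≤ τ ^ 2 * ((1 - 2 / τ ^ 2) - ⟪x, y⟫) := mul_nonneg (by positivity) (by linarith)
  nlinarith

lemma k_gt {τ : ℝ} (hT : 6 < τ ^ 2) : 2 / 3 < 1 - 2 / τ ^ 2 := by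
  have : 2 / τ ^ 2 < 1 / 3 := by rw [div_lt_div_iff₀ (by positivity) (by norm_num)]; linarith
  linarith

lemma Dfun_pos_iff {τ : ℝ} (hT : 6 < τ ^ 2) {x y : E3} (hx : x ∈ Sphere2) (hy : y ∈ Sphere2) :
    0 < Dfun τ x y ↔ 1 - 2 / τ ^ 2 < ⟪x, y⟫ := by
  constructor
  · intro h
    by_contra hc
    push Not at hc
    have h1 := Kf_neg_case hT hx hy hc
    rw [Kf_eq hx hy] at h1
    have := le_max_right 0 (Dfun τ x y)
    linarith
  · intro h
    rw [Dfun_eq hT]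
    have : 0 < τ ^ 2 * (⟪x, y⟫ - (1 - 2 / τ ^ 2)) := mul_pos (by positivity) (by linarith)
    have := k_gt hT
    have : 0 < 1 + ⟪x, y⟫ := by linarith
    positivity

lemma msupport_closed (ρ : Measure E3) : IsClosed (msupport ρ) := by
  rw [← isOpen_compl_iff, isOpen_iff_mem_nhds]
  intro x hx
  simp only [msupport, mem_compl_iff, Set.mem_ofPred_eq, not_forall, not_lt, nonpos_iff_eq_zero] at hx
  obtain ⟨U, hU, hxU, h⟩ := hx
  filter_upwards [hU.mem_nhds hxU] with y hy hyM
  exact (hyM U hU hy).ne' h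

structure Good (τ : ℝ) (ρ : Measure E3) (S : ℝ) : Prop where
  prob : IsProbabilityMeasure ρ
  null : ρ Sphere2ᶜ = 0
  sub : msupport ρ ⊆ Sphere2
  el1 : ∀ x ∈ Sphere2, S ≤ ∫ y, Kf τ x y ∂ρ
  el2 : ∀ x ∈ msupport ρ, ∫ y, Kf τ x y ∂ρ = S
  psd : ∀ s : Finset E3, (∀ x ∈ s, x ∈ msupport ρ) → ∀ c : E3 → ℝ,
    0 ≤ ∑ i ∈ s, ∑ j ∈ s, c i * c j * Kf τ i j

lemma good_of_min {τ : ℝ} {ρ : Measure E3} (h : IsMinimizer τ ρ) : ∃ S, Good τ ρ S := by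
  obtain ⟨hp, hreg, hnull, hmin⟩ := h
  have hcl : IsClosed Sphere2 := Metric.isClosed_sphere
  have hca : ∀ ν : Measure E3, ν Sphere2ᶜ = 0 →
      causalAction τ ν = ∫ x, ∫ y, Kf τ x y ∂ν ∂ν := by
    intro ν hν
    have hae : ∀ᵐ x ∂ν, x ∈ Sphere2 := hν
    unfold causalAction
    refine integral_congr_ae ?_
    filter_upwards [hae] with x hx
    refine integral_congr_ae ?_
    filter_upwards [hae] with y hy
    rw [Kf_eq hx hy]; rfl
  have hm : ∀ ρ' : Measure E3, IsProbabilityMeasure ρ' → ρ' Sphere2ᶜ = 0 →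
      ∫ x, ∫ y, Kf τ x y ∂ρ ∂ρ ≤ ∫ x, ∫ y, Kf τ x y ∂ρ' ∂ρ' := by
    intro ρ' hp' hn'
    rw [← hca ρ hnull, ← hca ρ' hn']
    exact hmin ρ' hp' inferInstance hn'
  refine ⟨∫ x, ∫ y, Kf τ x y ∂ρ ∂ρ, hp, hnull, ?_, ?_, ?_, ?_⟩
  · intro x hx
    by_contra hc
    exact (hx _ hcl.isOpen_compl hc).ne' hnull
  · exact EL1 (Kf_cont τ) (Kf_nonneg τ) (Kf_le τ) (Kf_symm τ) ρ _ hcl hnull hm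
  · exact EL2 (Kf_cont τ) (Kf_nonneg τ) (Kf_le τ) (Kf_symm τ) ρ _ hcl hnull hm
  · exact PSD (Kf_cont τ) (Kf_nonneg τ) (Kf_le τ) (Kf_symm τ) ρ _ hcl hnull hm

abbrev Feat := ℝ × (Fin 3 → ℝ) × (Fin 3 → Fin 3 → ℝ)

def feat (x : E3) : Feat := (1, fun i => x i, fun i j => x i * x j)

noncomputable def ellf (τ : ℝ) (y : E3) : Feat →ₗ[ℝ] ℝ where
  toFun a := (1 / 4) * ((2 - τ ^ 2) * a.1 + 2 * ∑ i, a.2.1 i * y i +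
    τ ^ 2 * ∑ i, ∑ j, a.2.2 i j * (y i * y j))
  map_add' a b := by simp [Fin.sum_univ_three]; ring
  map_smul' c a := by simp [Fin.sum_univ_three]; ring

lemma inner3 (x y : E3) : ⟪x, y⟫ = x 0 * y 0 + x 1 * y 1 + x 2 * y 2 := by
  simp [PiLp.inner_apply, Fin.sum_univ_three]; ring

lemma ellf_feat (τ : ℝ) (x y : E3) : ellf τ y (feat x) = Dfun τ x y := by
  simp only [ellf, feat, Dfun, inner3, LinearMap.coe_mk, AddHom.coe_mk, Fin.sum_univ_three]
  ring

lemma ext_lin {ι E : Type*} [AddCommGroup E] [Module ℝ E] (v : ι → E) (g : ι → ℝ)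
    (h : ∀ l : ι →₀ ℝ, Finsupp.linearCombination ℝ v l = 0 → Finsupp.linearCombination ℝ g l = 0) :
    ∃ Φ : E →ₗ[ℝ] ℝ, ∀ i, Φ (v i) = g i := by
  have h1 : (Finsupp.linearCombination ℝ g : (ι →₀ ℝ) →ₗ[ℝ] ℝ) ∈
      LinearMap.range (Finsupp.linearCombination ℝ v).dualMap := by
    rw [LinearMap.range_dualMap_eq_dualAnnihilator_ker, Submodule.mem_dualAnnihilator]
    intro l hl
    exact h l hl
  obtain ⟨Φ, hΦ⟩ := h1
  refine ⟨Φ, fun i => ?_⟩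
  have := LinearMap.congr_fun hΦ (Finsupp.single i 1)
  simpa using this

lemma dich {τ : ℝ} (hT : 6 < τ ^ 2) {ρ : Measure E3} {S : ℝ} (G : Good τ ρ S) (X : Set E3)
    (hXM : X ⊆ msupport ρ) (hXD : ∀ x ∈ X, ∀ x' ∈ X, 1 - 2 / τ ^ 2 < ⟪x, x'⟫) (hX : X.Infinite) :
    ∃ J ⊆ X, J.Infinite ∧ ∀ y ∈ msupport ρ,
      (∀ x ∈ J, 1 - 2 / τ ^ 2 ≤ ⟪x, y⟫) ∨ (∀ x ∈ J, ⟪x, y⟫ ≤ 1 - 2 / τ ^ 2) := by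
  classical
  -- linear functional
  have hΦ : ∀ y ∈ msupport ρ, ∃ Φ : Feat →ₗ[ℝ] ℝ, ∀ x ∈ X, Φ (feat x) = Kf τ x y := by
    intro y hy
    have := ext_lin (fun x : X => feat x) (fun x : X => Kf τ x y) (by
      intro l hl
      set l' : E3 →₀ ℝ := l.embDomain (Function.Embedding.subtype _) with hl'
      have hsupp : ∀ x ∈ l'.support, x ∈ X := by
        intro x hx
        rw [hl', Finsupp.support_embDomain, Finset.mem_map] at hx
        obtain ⟨z, _, rfl⟩ := hx
        exact z.2
      have hconv : ∀ {N : Type} [AddCommGroup N] [Module ℝ N] (f : E3 → N),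
          Finsupp.linearCombination ℝ (fun x : X => f x) l = ∑ x ∈ l'.support, l' x • f x := by
        intro N _ _ f
        have := Finsupp.linearCombination_embDomain ℝ (v' := f) (Function.Embedding.subtype (· ∈ X)) l
        rw [Finsupp.linearCombination_apply, Finsupp.sum] at this
        exact this.symm
      rw [hconv feat] at hl
      rw [hconv (fun x => Kf τ x y)]
      set s := insert y l'.support with hs
      have hz : ∀ x ∈ s, x ∉ l'.support → l' x = 0 := fun x _ hx => Finsupp.notMem_support_iff.1 hx
      have hsub : l'.support ⊆ s := Finset.subset_insert _ _
      have hsM : ∀ x ∈ s, x ∈ msupport ρ := by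
        intro x hx
        rcases Finset.mem_insert.1 hx with h | h
        · exact h ▸ hy
        · exact hXM (hsupp x h)
      have h0 := PSD0 (Kf_symm τ) s (G.psd s hsM) (fun x => l' x) (by
        have e1 : ∀ i, ∑ j ∈ s, l' i * l' j * Kf τ i j = ∑ j ∈ l'.support, l' i * l' j * Kf τ i j :=
          fun i => (Finset.sum_subset hsub fun x hx hx2 => by rw [hz x hx hx2]; ring).symm
        simp_rw [e1]
        rw [← Finset.sum_subset hsub (fun x hx hx2 => by rw [hz x hx hx2]; simp)]
        rw [Finset.sum_comm]
        refine Finset.sum_eq_zero fun j hj => ?_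
        have e2 : ∑ i ∈ l'.support, l' i * l' j * Kf τ i j
            = l' j * ellf τ j (∑ i ∈ l'.support, l' i • feat i) := by
          rw [map_sum, Finset.mul_sum]
          refine Finset.sum_congr rfl fun i hi => ?_
          rw [map_smul, ellf_feat, Kf_pos_case hT (G.sub (hXM (hsupp i hi))) (G.sub (hXM (hsupp j hj)))
            (hXD i (hsupp i hi) j (hsupp j hj)).le, smul_eq_mul]
          ring
        rw [e2, hl, map_zero, mul_zero]) y (Finset.mem_insert_self _ _)
      rw [← h0]
      exact Finset.sum_subset hsub fun x hx hx2 => by rw [hz x hx hx2]; simp)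
    obtain ⟨Φ, h⟩ := this
    exact ⟨Φ, fun x hx => h ⟨x, hx⟩⟩
  -- choice of J
  have hex : ∃ n, ∃ J ⊆ X, J.Infinite ∧ Module.finrank ℝ (Submodule.span ℝ (feat '' J)) = n :=
    ⟨_, X, Subset.rfl, hX, rfl⟩
  obtain ⟨J, hJX, hJ, hJn⟩ := Nat.find_spec hex
  have hJmin : ∀ J' ⊆ J, J'.Infinite → ∀ Φ : Feat →ₗ[ℝ] ℝ, (∀ x ∈ J', Φ (feat x) = 0) →
      ∀ x ∈ J, Φ (feat x) = 0 := by
    intro J' hJ' hinf Φ hΦ0 x hx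
    have h1 := Nat.find_min' hex ⟨J', hJ'.trans hJX, hinf, rfl⟩
    rw [← hJn] at h1
    have h2 := Submodule.eq_of_le_of_finrank_le (Submodule.span_mono (R := ℝ) (image_mono (f := feat) hJ')) h1
    have h3 : Submodule.span ℝ (feat '' J') ≤ LinearMap.ker Φ := by
      rw [Submodule.span_le]
      rintro _ ⟨z, hz, rfl⟩
      exact hΦ0 z hz
    rw [h2] at h3
    exact h3 (Submodule.subset_span ⟨x, hx, rfl⟩)
  refine ⟨J, hJX, hJ, fun y hy => ?_⟩
  obtain ⟨Φ, hΦ⟩ := hΦ y hy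
  have hyS := G.sub hy
  have hk := k_gt hT
  by_cases hfin : {x ∈ J | 1 - 2 / τ ^ 2 < ⟪x, y⟫}.Infinite
  · left
    intro x hx
    have h1 := hJmin _ (sep_subset _ _) hfin (Φ - ellf τ y) (by
      rintro z ⟨hz, hz2⟩
      rw [LinearMap.sub_apply, hΦ z (hJX hz), ellf_feat,
        Kf_pos_case hT (G.sub (hXM (hJX hz))) hyS hz2.le, sub_self]) x hx
    rw [LinearMap.sub_apply, hΦ x (hJX hx), ellf_feat] at h1
    have hxS := G.sub (hXM (hJX hx))
    have hD : 0 ≤ Dfun τ x y := by linarith [Kf_nonneg τ x y]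
    by_contra hc
    push Not at hc
    rw [Dfun_eq hT] at hD
    have h2 := sph_ge hxS hyS
    have h3 : 0 < τ ^ 2 * ((1 - 2 / τ ^ 2) - ⟪x, y⟫) := mul_pos (by positivity) (by linarith)
    have h4 : ⟪x, y⟫ = -1 := by nlinarith
    have h5 : x = -y := by
      have : ⟪x, -y⟫ = 1 := by rw [inner_neg_right, h4, neg_neg]
      exact (inner_eq_one_iff_of_norm_eq_one (sph_norm hxS) (by rw [norm_neg, sph_norm hyS])).1 this
    obtain ⟨z, hz, hz2⟩ := hfin.nonempty
    have h6 := hXD z (hJX hz) x (hJX hx)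
    rw [h5, inner_neg_right] at h6
    linarith
  · right
    have hinf : {x ∈ J | ⟪x, y⟫ ≤ 1 - 2 / τ ^ 2}.Infinite := by
      have := hJ.sdiff (not_infinite.1 hfin)
      refine this.mono ?_
      rintro x ⟨hx, hx2⟩
      exact ⟨hx, not_lt.1 fun h => hx2 ⟨hx, h⟩⟩
    intro x hx
    have h1 := hJmin _ (sep_subset _ _) hinf Φ (by
      rintro z ⟨hz, hz2⟩
      rw [hΦ z (hJX hz), Kf_neg_case hT (G.sub (hXM (hJX hz))) hyS hz2]) x hx
    rw [hΦ x (hJX hx)] at h1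
    by_contra hc
    push Not at hc
    have hxS := G.sub (hXM (hJX hx))
    have := (Dfun_pos_iff hT hxS hyS).2 hc
    rw [Kf_pos_case hT hxS hyS hc.le] at h1
    linarith


lemma norm_sq_sph {x z : E3} (hx : x ∈ Sphere2) (hz : z ∈ Sphere2) :
    ‖x - z‖ ^ 2 = 2 - 2 * ⟪x, z⟫ := by
  rw [norm_sub_sq_real, sph_norm hx, sph_norm hz]; ring

lemma perp_bound {x z y : E3} (hx : x ∈ Sphere2) (hz : z ∈ Sphere2) (hy : y ∈ Sphere2) :
    ⟪x - ⟪x, z⟫ • z, y⟫ ^ 2 ≤ ‖x - z‖ ^ 2 * (1 - ⟪z, y⟫ ^ 2) := by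
  have hxx : ⟪x, x⟫ = 1 := by rw [real_inner_self_eq_norm_sq, sph_norm hx]; norm_num
  have hzz : ⟪z, z⟫ = 1 := by rw [real_inner_self_eq_norm_sq, sph_norm hz]; norm_num
  have hyy : ⟪y, y⟫ = 1 := by rw [real_inner_self_eq_norm_sq, sph_norm hy]; norm_num
  have h := real_inner_mul_inner_self_le (x - ⟪x, z⟫ • z) (y - ⟪z, y⟫ • z)
  have e1 : ⟪x - ⟪x, z⟫ • z, y - ⟪z, y⟫ • z⟫ = ⟪x - ⟪x, z⟫ • z, y⟫ := by
    simp only [inner_sub_left, inner_sub_right, inner_smul_left, inner_smul_right, hzz]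
    simp
  have e2 : ⟪x - ⟪x, z⟫ • z, x - ⟪x, z⟫ • z⟫ = 1 - ⟪x, z⟫ ^ 2 := by
    simp only [inner_sub_left, inner_sub_right, inner_smul_left, inner_smul_right, hzz, hxx,
      real_inner_comm z x]
    simp; rw [real_inner_comm]; ring
  have e3 : ⟪y - ⟪z, y⟫ • z, y - ⟪z, y⟫ • z⟫ = 1 - ⟪z, y⟫ ^ 2 := by
    simp only [inner_sub_left, inner_sub_right, inner_smul_left, inner_smul_right, hzz, hyy]
    simp; rw [real_inner_comm z y]; ring
  rw [e1, e2, e3] at h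
  rw [norm_sq_sph hx hz, sq]
  have h1 := sph_le hx hz
  have h2 := sph_ge hx hz
  have h3 := sph_le hz hy
  have h4 := sph_ge hz hy
  have h5 : 0 ≤ 1 - ⟪z, y⟫ ^ 2 := by nlinarith
  refine h.trans (mul_le_mul_of_nonneg_right ?_ h5)
  nlinarith [sq_nonneg (1 - ⟪x, z⟫)]

lemma conc_real {T u d r : ℝ} (hT : 6 < T) (hu : 1 - 2 / T ≤ u) (hu1 : u ≤ 1) (hr0 : 0 ≤ r)
    (hr1 : r ≤ 1) (hr : 4 * T * r ≤ (T - 1) * (T - 6) / T) (hd : d ^ 2 ≤ r ^ 2 * (1 - u ^ 2)) :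
    2 * (1 + T * u) * (d - r ^ 2 / 2 * u) + T * (d - r ^ 2 / 2 * u) ^ 2 ≤
      2 * (1 + T * u) * d - (T - 1) * (T - 6) / T / 2 * r ^ 2 := by
  set g := (T - 1) * (T - 6) / T with hg
  have hk : 2 / 3 < 1 - 2 / T := by
    have : 2 / T < 1 / 3 := by rw [div_lt_div_iff₀ (by positivity) (by norm_num)]; linarith
    linarith
  have hgk : g ≤ u + 2 * T * u ^ 2 - T := by
    have e : g = (1 - 2 / T) + 2 * T * (1 - 2 / T) ^ 2 - T := by
      rw [hg]; field_simp; ring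
    rw [e]
    have : (1 - 2 / T) ^ 2 ≤ u ^ 2 := by apply pow_le_pow_left₀ <;> linarith
    nlinarith
  have hdr : |d| ≤ r := by
    apply abs_le_of_sq_le_sq _ hr0
    nlinarith [mul_nonneg (sq_nonneg r) (sq_nonneg u)]
  have hΔ : (d - r ^ 2 / 2 * u) ^ 2 ≤ r ^ 2 * (1 - u ^ 2) + 2 * r ^ 3 := by
    have h1 : -(r ^ 2 * u * d) ≤ r ^ 3 := by
      have h2 : -(u * d) ≤ r := by
        have := (abs_le.1 hdr)
        have hu0 : 0 ≤ u := by linarith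
        nlinarith [this.1, this.2]
      nlinarith [mul_le_mul_of_nonneg_left h2 (sq_nonneg r)]
    have h3 : r ^ 4 * u ^ 2 / 4 ≤ r ^ 3 := by
      have : u ^ 2 ≤ 1 := by nlinarith
      have h5 : r ^ 4 ≤ r ^ 3 := pow_le_pow_of_le_one hr0 hr1 (by norm_num)
      have : r ^ 4 * u ^ 2 ≤ r ^ 4 * 1 := mul_le_mul_of_nonneg_left this (by positivity)
      nlinarith [pow_nonneg hr0 3]
    nlinarith
  have h6 : r ^ 2 * (4 * T * r) ≤ r ^ 2 * g := mul_le_mul_of_nonneg_left hr (sq_nonneg r)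
  have h7 : r ^ 2 * g ≤ r ^ 2 * (u + 2 * T * u ^ 2 - T) := mul_le_mul_of_nonneg_left hgk (sq_nonneg r)
  have h8 : T * (d - r ^ 2 / 2 * u) ^ 2 ≤ T * (r ^ 2 * (1 - u ^ 2) + 2 * r ^ 3) :=
    mul_le_mul_of_nonneg_left hΔ (by linarith)
  nlinarith

lemma conc_pt {τ : ℝ} (hT : 6 < τ ^ 2) {x z y : E3} (hx : x ∈ Sphere2) (hz : z ∈ Sphere2)
    (hy : y ∈ Sphere2) (hu : 1 - 2 / τ ^ 2 ≤ ⟪z, y⟫) (hr1 : ‖x - z‖ ≤ 1)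
    (hr : 4 * τ ^ 2 * ‖x - z‖ ≤ (τ ^ 2 - 1) * (τ ^ 2 - 6) / τ ^ 2) :
    4 * Dfun τ x y ≤ 4 * Dfun τ z y + 2 * (1 + τ ^ 2 * ⟪z, y⟫) * ⟪x - ⟪x, z⟫ • z, y⟫
      - (τ ^ 2 - 1) * (τ ^ 2 - 6) / τ ^ 2 / 2 * ‖x - z‖ ^ 2 := by
  have h := conc_real hT hu (sph_le hz hy) (norm_nonneg _) hr1 hr (perp_bound hx hz hy)
  have e : ⟪x, y⟫ = ⟪z, y⟫ + (⟪x - ⟪x, z⟫ • z, y⟫ - ‖x - z‖ ^ 2 / 2 * ⟪z, y⟫) := by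
    rw [norm_sq_sph hx hz, inner_sub_left, inner_smul_left]
    simp; ring
  set Δ := ⟪x - ⟪x, z⟫ • z, y⟫ - ‖x - z‖ ^ 2 / 2 * ⟪z, y⟫ with hΔ
  unfold Dfun
  rw [e]
  nlinarith

lemma inner_diff {x z y : E3} (hy : y ∈ Sphere2) : |⟪x, y⟫ - ⟪z, y⟫| ≤ ‖x - z‖ := by
  rw [← inner_sub_left]
  have := abs_real_inner_le_norm (x - z) y
  rwa [sph_norm hy, mul_one] at this

/-- the second test point -/
lemma refl_pt {x z : E3} (hx : x ∈ Sphere2) (hz : z ∈ Sphere2) {a : ℝ} (ha0 : 0 < a)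
    (ha1 : a ≤ 1 / 2) : ∃ x' ∈ Sphere2, ‖x' - z‖ ≤ 2 * a * ‖x - z‖ ∧
      x' - ⟪x', z⟫ • z = (-a) • (x - ⟪x, z⟫ • z) := by
  have hxx : ⟪x, x⟫ = 1 := by rw [real_inner_self_eq_norm_sq, sph_norm hx]; norm_num
  have hzz : ⟪z, z⟫ = 1 := by rw [real_inner_self_eq_norm_sq, sph_norm hz]; norm_num
  set w := x - ⟪x, z⟫ • z with hw
  have hwz : ⟪w, z⟫ = 0 := by
    rw [hw, inner_sub_left, inner_smul_left, hzz]; simp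
  have hww : ⟪w, w⟫ = 1 - ⟪x, z⟫ ^ 2 := by
    rw [hw]
    simp only [inner_sub_left, inner_sub_right, inner_smul_left, inner_smul_right, hzz, hxx]
    simp; rw [real_inner_comm x z]; ring
  have h1 := sph_le hx hz
  have h2 := sph_ge hx hz
  set b := 1 - a ^ 2 * ⟪w, w⟫ with hb
  have hw0 : 0 ≤ ⟪w, w⟫ := real_inner_self_nonneg
  have hw1 : ⟪w, w⟫ ≤ 1 := by rw [hww]; nlinarith [sq_nonneg ⟪x, z⟫]
  have ha2 : a ^ 2 ≤ 1 := by nlinarith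
  have hb0 : 0 ≤ b := by nlinarith [mul_le_mul ha2 hw1 hw0 zero_le_one]
  have hsq : Real.sqrt b ^ 2 = b := Real.sq_sqrt hb0
  have hb1 : b ≤ 1 := by nlinarith [mul_nonneg (sq_nonneg a) hw0]
  have hsb : b ≤ Real.sqrt b := by
    have : Real.sqrt b ≤ 1 := Real.sqrt_le_iff.2 ⟨by norm_num, by linarith⟩
    nlinarith [Real.sqrt_nonneg b]
  set x' := Real.sqrt b • z - a • w with hx'
  have ixz : ⟪x', z⟫ = Real.sqrt b := by
    rw [hx', inner_sub_left, inner_smul_left, inner_smul_left, hzz, hwz]; simp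
  have ixx : ⟪x', x'⟫ = 1 := by
    rw [hx']
    simp only [inner_sub_left, inner_sub_right, inner_smul_left, inner_smul_right, hzz, hwz,
      real_inner_comm w z]
    simp
    rw [← sub_eq_zero]
    have : √b * √b = b := Real.mul_self_sqrt hb0
    rw [this, hb, real_inner_self_eq_norm_sq]; ring
  have hS : x' ∈ Sphere2 := by
    simp only [Sphere2, mem_sphere_zero_iff_norm]
    rw [real_inner_self_eq_norm_sq] at ixx
    nlinarith [norm_nonneg x']
  refine ⟨x', hS, ?_, ?_⟩
  · apply le_of_sq_le_sq _ (by positivity)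
    rw [norm_sq_sph hS hz, ixz, mul_pow, norm_sq_sph hx hz]
    have : a ^ 2 * ⟪w, w⟫ ≤ a ^ 2 * (2 - 2 * ⟪x, z⟫) := by
      apply mul_le_mul_of_nonneg_left _ (sq_nonneg a)
      rw [hww]; nlinarith [sq_nonneg (1 - ⟪x, z⟫)]
    nlinarith
  · rw [ixz, hx']; simp


lemma K_bound {τ : ℝ} (hT : 6 < τ ^ 2) (P : Set E3) {x z y : E3} (hx : x ∈ Sphere2)
    (hz : z ∈ Sphere2) (hy : y ∈ Sphere2) (h1 : y ∈ P → 1 - 2 / τ ^ 2 ≤ ⟪z, y⟫)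
    (h2 : y ∉ P → ⟪z, y⟫ ≤ 1 - 2 / τ ^ 2) :
    Kf τ x y ≤ P.indicator (fun y => Dfun τ x y) y +
      {y | |⟪z, y⟫ - (1 - 2 / τ ^ 2)| ≤ ‖x - z‖}.indicator (fun _ => τ ^ 2 / 2 * ‖x - z‖) y := by
  have hd := abs_le.1 (inner_diff (x := x) (z := z) hy)
  have hnn : 0 ≤ {y : E3 | |⟪z, y⟫ - (1 - 2 / τ ^ 2)| ≤ ‖x - z‖}.indicator
      (fun _ => τ ^ 2 / 2 * ‖x - z‖) y := indicator_nonneg (fun _ _ => by positivity) y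
  have hx1 := sph_le hx hy
  have hx2 := sph_ge hx hy
  by_cases hP : y ∈ P
  · rw [indicator_of_mem hP]
    by_cases hk : 1 - 2 / τ ^ 2 ≤ ⟪x, y⟫
    · rw [Kf_pos_case hT hx hy hk]; linarith
    · push Not at hk
      have h3 := h1 hP
      rw [Kf_neg_case hT hx hy hk.le, indicator_of_mem, Dfun_eq hT]
      · have : (1 + ⟪x, y⟫) * (τ ^ 2 * ((1 - 2 / τ ^ 2) - ⟪x, y⟫)) ≤ 2 * (τ ^ 2 * ‖x - z‖) := by
          apply mul_le_mul (by linarith) _ (mul_nonneg (by positivity) (by linarith)) (by norm_num)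
          apply mul_le_mul_of_nonneg_left _ (by positivity)
          linarith [hd.1]
        linarith
      · rw [Set.mem_ofPred_eq, abs_le]; constructor <;> linarith [hd.1, hd.2, norm_nonneg (x - z)]
  · rw [indicator_of_notMem hP, zero_add]
    have h3 := h2 hP
    by_cases hk : 1 - 2 / τ ^ 2 < ⟪x, y⟫
    · rw [Kf_pos_case hT hx hy hk.le, indicator_of_mem, Dfun_eq hT]
      · have : (1 + ⟪x, y⟫) * (τ ^ 2 * (⟪x, y⟫ - (1 - 2 / τ ^ 2))) ≤ 2 * (τ ^ 2 * ‖x - z‖) := by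
          apply mul_le_mul (by linarith) _ (mul_nonneg (by positivity) (by linarith)) (by norm_num)
          apply mul_le_mul_of_nonneg_left _ (by positivity)
          linarith [hd.2]
        linarith
      · rw [Set.mem_ofPred_eq, abs_le]; constructor <;> linarith [hd.1, hd.2, norm_nonneg (x - z)]
    · push Not at hk
      rw [Kf_neg_case hT hx hy hk]; exact hnn

lemma S_pos {τ : ℝ} {ρ : Measure E3} {S : ℝ} (G : Good τ ρ S) {z : E3} (hz : z ∈ msupport ρ) :
    0 < S := by
  have := G.prob
  have hi := K_int (Kf_cont τ) (Kf_nonneg τ) (Kf_le τ) ρ z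
  have hzS := G.sub hz
  have hzz : ⟪z, z⟫ = 1 := by rw [real_inner_self_eq_norm_sq, sph_norm hzS]; norm_num
  have hK : 0 < Kf τ z z := by
    rw [Kf_eq hzS hzS]
    unfold Dfun
    rw [hzz]; norm_num
  rw [← G.el2 z hz]
  rw [integral_pos_iff_support_of_nonneg (fun y => Kf_nonneg τ z y) hi]
  have hc : Continuous (Kf τ z) := (Kf_cont τ).comp (by fun_prop : Continuous fun y : E3 => (z, y))
  exact hz _ hc.isOpen_support hK.ne'

/-- main local estimate -/
lemma local_est {τ : ℝ} (hT : 6 < τ ^ 2) {ρ : Measure E3} {S : ℝ} (G : Good τ ρ S) (J : Set E3)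
    (hJM : J ⊆ msupport ρ) (hJ : ∀ y ∈ msupport ρ,
      (∀ x ∈ J, 1 - 2 / τ ^ 2 ≤ ⟪x, y⟫) ∨ (∀ x ∈ J, ⟪x, y⟫ ≤ 1 - 2 / τ ^ 2))
    (hJ1 : ∀ x ∈ J, ∀ z ∈ J, ‖x - z‖ ≤ 1 ∧
      4 * τ ^ 2 * ‖x - z‖ ≤ (τ ^ 2 - 1) * (τ ^ 2 - 6) / τ ^ 2) (hne : J.Nonempty) :
    ∃ m > 0, ∀ x ∈ J, ∀ z ∈ J, m * ‖x - z‖ ≤ ρ.real {y | ⟪z, y⟫ = 1 - 2 / τ ^ 2} := by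
  have hprob := G.prob
  set k := 1 - 2 / τ ^ 2 with hk
  set g := (τ ^ 2 - 1) * (τ ^ 2 - 6) / τ ^ 2 with hg
  have hg0 : 0 < g := by
    rw [hg]; apply div_pos (mul_pos _ _) <;> linarith
  set P : Set E3 := {y | y ∈ Sphere2 ∧ ∀ x ∈ J, k ≤ ⟪x, y⟫} with hP
  have hPcl : IsClosed P := by
    have : P = Sphere2 ∩ ⋂ x ∈ J, {y | k ≤ ⟪x, y⟫} := by ext y; simp [hP]
    rw [this]
    refine Metric.isClosed_sphere.inter (isClosed_biInter fun x _ => ?_)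
    exact isClosed_le continuous_const (by fun_prop)
  have hPm : MeasurableSet P := hPcl.measurableSet
  have hPc : IsCompact P := (isCompact_sphere (0 : E3) 1).of_isClosed_subset hPcl (fun y hy => hy.1)
  have hMae := msupport_ae ρ
  have hintP : ∀ f : E3 → ℝ, Continuous f → IntegrableOn f P ρ := fun f hf =>
    hf.continuousOn.integrableOn_compact hPc
  have hDc : ∀ x, Continuous (fun y => Dfun τ x y) := fun x =>
    (Dfun_cont τ).comp (by fun_prop : Continuous fun y : E3 => (x, y))
  -- F on J
  have hF : ∀ z ∈ J, ∫ y in P, Dfun τ z y ∂ρ = S := by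
    intro z hz
    rw [← G.el2 z (hJM hz), ← integral_indicator hPm]
    refine integral_congr_ae ?_
    filter_upwards [hMae] with y hy
    have hyS := G.sub hy
    have hzS := G.sub (hJM hz)
    by_cases hyP : y ∈ P
    · rw [indicator_of_mem hyP, Kf_pos_case hT hzS hyS (hyP.2 z hz)]
    · rw [indicator_of_notMem hyP, Kf_neg_case hT hzS hyS]
      rcases hJ y hy with h | h
      · exact absurd ⟨hyS, h⟩ hyP
      · exact h z hz
  set m := ρ.real P with hm
  have hm0 : 0 < m := by
    obtain ⟨z, hz⟩ := hne
    have h1 := S_pos G (hJM hz)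
    rw [← hF z hz] at h1
    rcases (measureReal_nonneg : 0 ≤ ρ.real P).lt_or_eq with h | h
    · exact h
    · exfalso
      have : ρ P = 0 := by
        rw [measureReal_def, eq_comm, ENNReal.toReal_eq_zero_iff] at h
        exact h.resolve_right (measure_ne_top _ _)
      rw [setIntegral_measure_zero _ this] at h1
      exact lt_irrefl _ h1
  set Γ : E3 → E3 → ℝ := fun z w => ∫ y in P, 2 * (1 + τ ^ 2 * ⟪z, y⟫) * ⟪w, y⟫ ∂ρ with hΓ
  -- integrated concavity
  have hconc : ∀ x ∈ Sphere2, ∀ z ∈ J, ‖x - z‖ ≤ 1 → 4 * τ ^ 2 * ‖x - z‖ ≤ g →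
      4 * ∫ y in P, Dfun τ x y ∂ρ ≤ 4 * S + Γ z (x - ⟪x, z⟫ • z) - g / 2 * ‖x - z‖ ^ 2 * m := by
    intro x hx z hz hr1 hr2
    have i1 := (hintP _ (hDc x)).const_mul 4
    have i2 := (hintP _ (hDc z)).const_mul 4
    have i3 := hintP (fun y => 2 * (1 + τ ^ 2 * ⟪z, y⟫) * ⟪x - ⟪x, z⟫ • z, y⟫) (by fun_prop)
    have i4 : IntegrableOn (fun _ : E3 => g / 2 * ‖x - z‖ ^ 2) P ρ := hintP _ continuous_const
    have i23 : IntegrableOn (fun y => 4 * Dfun τ z y + 2 * (1 + τ ^ 2 * ⟪z, y⟫) * ⟪x - ⟪x, z⟫ • z, y⟫) P ρ :=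
      i2.add i3
    have i5 : IntegrableOn (fun y => 4 * Dfun τ z y + 2 * (1 + τ ^ 2 * ⟪z, y⟫) * ⟪x - ⟪x, z⟫ • z, y⟫
      - g / 2 * ‖x - z‖ ^ 2) P ρ := i23.sub i4
    have h := setIntegral_mono_on i1 i5 hPm (fun y hy =>
      conc_pt hT hx (G.sub (hJM hz)) hy.1 (hy.2 z hz) hr1 hr2)
    rw [integral_sub i23 i4, integral_add i2 i3, integral_const_mul, integral_const_mul, hF z hz,
      setIntegral_const, smul_eq_mul] at h
    rw [hΓ]
    simp only
    linarith
  -- upper bound for S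
  have hupp : ∀ x ∈ Sphere2, ∀ z ∈ J, S ≤ (∫ y in P, Dfun τ x y ∂ρ) +
      τ ^ 2 / 2 * ‖x - z‖ * ρ.real {y | |⟪z, y⟫ - k| ≤ ‖x - z‖} := by
    intro x hx z hz
    set A : Set E3 := {y | |⟪z, y⟫ - k| ≤ ‖x - z‖} with hA
    have hAm : MeasurableSet A := (isClosed_le (by fun_prop) continuous_const).measurableSet
    have j1 : Integrable (P.indicator (fun y => Dfun τ x y)) ρ :=
      (integrable_indicator_iff hPm).2 (hintP _ (hDc x))
    have j2 : Integrable (A.indicator (fun _ => τ ^ 2 / 2 * ‖x - z‖)) ρ :=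
      (integrable_const _).indicator hAm
    have j3 : Integrable (fun y => P.indicator (fun y => Dfun τ x y) y +
      A.indicator (fun _ => τ ^ 2 / 2 * ‖x - z‖) y) ρ := j1.add j2
    have h := integral_mono_ae (K_int (Kf_cont τ) (Kf_nonneg τ) (Kf_le τ) ρ x) j3 (by
      filter_upwards [hMae] with y hy
      have hyS := G.sub hy
      refine K_bound hT P hx (G.sub (hJM hz)) hyS (fun h => h.2 z hz) fun hyP => ?_
      rcases hJ y hy with h | h
      · exact absurd ⟨hyS, h⟩ hyP
      · exact h z hz)
    rw [integral_add j1 j2, integral_indicator hPm, integral_indicator_const _ hAm, smul_eq_mul] at h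
    have := G.el1 x hx
    linarith
  refine ⟨g / 2 * m / (4 * τ ^ 2), by positivity, fun x hx z hz => ?_⟩
  have hxS := G.sub (hJM hx)
  have hzS := G.sub (hJM hz)
  obtain ⟨hr1, hr2⟩ := hJ1 x hx z hz
  rcases (norm_nonneg (x - z)).eq_or_lt with h0 | h0
  · rw [← h0, mul_zero]; exact measureReal_nonneg
  have hstep : ∀ a : ℝ, 0 < a → a ≤ 1 / 2 → g / 2 * m / (4 * τ ^ 2) * ‖x - z‖ ≤
      ρ.real {y | |⟪z, y⟫ - k| ≤ 2 * a * ‖x - z‖} := by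
    intro a ha0 ha1
    obtain ⟨x', hx', hxr, hxw⟩ := refl_pt hxS hzS ha0 ha1
    have hxr2 : ‖x' - z‖ ≤ ‖x - z‖ := hxr.trans (by nlinarith)
    have c1 := hconc x hxS z hz hr1 hr2
    rw [hF x hx] at c1
    have c2 := hconc x' hx' z hz (hxr2.trans hr1)
      ((mul_le_mul_of_nonneg_left hxr2 (by positivity)).trans hr2)
    have c3 := hupp x' hx' z hz
    have e : Γ z (x' - ⟪x', z⟫ • z) = -a * Γ z (x - ⟪x, z⟫ • z) := by
      rw [hxw, hΓ]
      simp only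
      rw [← integral_const_mul]
      congr 1; funext y
      rw [inner_smul_left]; simp; ring
    rw [e] at c2
    have hmono : ρ.real {y | |⟪z, y⟫ - k| ≤ ‖x' - z‖} ≤ ρ.real {y | |⟪z, y⟫ - k| ≤ 2 * a * ‖x - z‖} :=
      measureReal_mono (fun y hy => le_trans hy hxr)
    set R := ρ.real {y | |⟪z, y⟫ - k| ≤ 2 * a * ‖x - z‖} with hR
    have hR0 : 0 ≤ R := measureReal_nonneg
    have c4 : τ ^ 2 / 2 * ‖x' - z‖ * ρ.real {y | |⟪z, y⟫ - k| ≤ ‖x' - z‖} ≤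
        τ ^ 2 / 2 * (2 * a * ‖x - z‖) * R :=
      mul_le_mul (mul_le_mul_of_nonneg_left hxr (by positivity)) hmono measureReal_nonneg
        (by positivity)
    have c5 : 0 ≤ g / 2 * ‖x' - z‖ ^ 2 * m := by positivity
    have c6 : a * (g / 2 * ‖x - z‖ ^ 2 * m) ≤ a * Γ z (x - ⟪x, z⟫ • z) :=
      mul_le_mul_of_nonneg_left (by linarith) ha0.le
    have c7 : (a * ‖x - z‖) * (g / 2 * m * ‖x - z‖) ≤ (a * ‖x - z‖) * (4 * τ ^ 2 * R) := by
      nlinarith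
    have c8 := le_of_mul_le_mul_left c7 (by positivity)
    rw [div_mul_eq_mul_div, div_le_iff₀ (by positivity)]
    linarith
  -- limit
  have hlim : Filter.Tendsto (fun n : ℕ => ρ {y | |⟪z, y⟫ - k| ≤ 2 * (1 / ((n : ℝ) + 2)) * ‖x - z‖})
      Filter.atTop (nhds (ρ {y | ⟪z, y⟫ = k})) := by
    refine tendsto_measure_of_ae_tendsto_indicator_of_isFiniteMeasure Filter.atTop ?_ ?_ ?_
    · exact (isClosed_eq (by fun_prop) continuous_const).measurableSet
    · intro n; exact (isClosed_le (by fun_prop) continuous_const).measurableSet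
    · filter_upwards with y
      by_cases hy : ⟪z, y⟫ = k
      · filter_upwards with n
        simp only [Set.mem_ofPred_eq, hy, sub_self, abs_zero, iff_true]
        positivity
      · have hpos : 0 < |⟪z, y⟫ - k| := abs_pos.2 (sub_ne_zero.2 hy)
        have ht : Filter.Tendsto (fun n : ℕ => 2 * (1 / ((n : ℝ) + 2)) * ‖x - z‖) Filter.atTop (nhds 0) := by
          have h1 : Filter.Tendsto (fun n : ℕ => 1 / ((n : ℝ) + 2)) Filter.atTop (nhds 0) := by
            have := (tendsto_one_div_add_atTop_nhds_zero_nat (𝕜 := ℝ)).comp (Filter.tendsto_add_atTop_nat 1)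
            refine this.congr fun n => ?_
            simp only [Function.comp]; push_cast; ring_nf
          have := (h1.const_mul 2).mul_const ‖x - z‖
          simpa using this
        filter_upwards [ht.eventually (gt_mem_nhds hpos)] with n hn
        simp only [Set.mem_ofPred_eq, hy, iff_false, not_le]
        exact hn
  have hlim2 := (ENNReal.tendsto_toReal (measure_ne_top ρ _)).comp hlim
  refine ge_of_tendsto' hlim2 fun n => ?_
  refine hstep (1 / ((n : ℝ) + 2)) (by positivity) ?_
  rw [div_le_div_iff₀ (by positivity) (by norm_num)]
  have : (0 : ℝ) ≤ n := Nat.cast_nonneg n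
  linarith


lemma claimR {τ : ℝ} (hT : 6 < τ ^ 2) {ρ : Measure E3} {S : ℝ} (G : Good τ ρ S) (q : E3)
    (X : Set E3) (hXM : X ⊆ msupport ρ) (hXi : X.Infinite)
    (hXq : ∀ r > 0, (X \ Metric.ball q r).Finite) :
    ∃ y ∈ msupport ρ, {x ∈ X | ⟪x, y⟫ = 1 - 2 / τ ^ 2}.Infinite := by
  by_contra hcon
  push Not at hcon
  have hprob := G.prob
  set g := (τ ^ 2 - 1) * (τ ^ 2 - 6) / τ ^ 2 with hg
  have hg0 : 0 < g := by
    rw [hg]; apply div_pos (mul_pos _ _) <;> linarith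
  set r := min (1 / τ ^ 2) (g / (4 * τ ^ 2)) with hr
  have hr0 : 0 < r := lt_min (by positivity) (by positivity)
  have hrT : r ≤ 1 / τ ^ 2 := min_le_left _ _
  have hrg : 4 * τ ^ 2 * r ≤ g := by
    have := min_le_right (1 / τ ^ 2) (g / (4 * τ ^ 2))
    rw [← hr, le_div_iff₀ (by positivity)] at this
    linarith
  have hT1 : 1 / τ ^ 2 ≤ 1 := by rw [div_le_one (by positivity)]; linarith
  set X' := X ∩ Metric.ball q (r / 2) with hX'
  have hX'i : X'.Infinite := by
    have := hXi.sdiff (hXq (r / 2) (by positivity))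
    refine this.mono ?_
    rintro x ⟨hx, hx2⟩
    exact ⟨hx, by_contra fun h => hx2 ⟨hx, h⟩⟩
  have hdist : ∀ x ∈ X', ∀ z ∈ X', ‖x - z‖ ≤ r := by
    intro x hx z hz
    have h1 : dist x q < r / 2 := hx.2
    have h2 : dist z q < r / 2 := hz.2
    have := dist_triangle_right x z q
    rw [← dist_eq_norm]; linarith
  obtain ⟨J, hJX, hJi, hJ⟩ := dich hT G X' (inter_subset_left.trans hXM) (by
    intro x hx z hz
    have h1 := norm_sq_sph (G.sub (hXM hx.1)) (G.sub (hXM hz.1))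
    have h2 := hdist x hx z hz
    have h3 : ‖x - z‖ ^ 2 ≤ r ^ 2 := pow_le_pow_left₀ (norm_nonneg _) h2 2
    have h4 : r ^ 2 ≤ 1 / τ ^ 2 := by nlinarith
    have h5 : 0 < 1 / τ ^ 2 := by positivity
    have h6 : 2 / τ ^ 2 = 2 * (1 / τ ^ 2) := by ring
    rw [h6]
    linarith) hX'i
  have hJXX : J ⊆ X := hJX.trans inter_subset_left
  obtain ⟨m, hm0, hm⟩ := local_est hT G J (hJXX.trans hXM) hJ (by
    intro x hx z hz
    have h2 := hdist x (hJX hx) z (hJX hz)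
    exact ⟨by linarith, (mul_le_mul_of_nonneg_left h2 (by positivity)).trans hrg⟩) hJi.nonempty
  set f := hJi.natEmbedding J with hf
  have hfinj : Function.Injective (fun n => (f n : E3)) := fun a b h => f.injective (Subtype.ext h)
  have hfin : ∀ s : Set E3, s.Finite → ∀ᶠ n in Filter.atTop, (f n : E3) ∉ s := by
    intro s hs
    have h1 : ((fun n => (f n : E3)) ⁻¹' s).Finite := hs.preimage hfinj.injOn
    have := h1.eventually_cofinite_notMem
    rw [Nat.cofinite_eq_atTop] at this
    exact this
  have hfq : Filter.Tendsto (fun n => (f n : E3)) Filter.atTop (nhds q) := by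
    rw [Metric.tendsto_atTop']
    intro ε hε
    obtain ⟨N, hN⟩ := Filter.eventually_atTop.1 (hfin _ (hXq ε hε))
    refine ⟨N, fun n hn => ?_⟩
    by_contra hc
    exact hN n hn.le ⟨hJXX (f n).2, hc⟩
  obtain ⟨x, hxJ, hxq⟩ := (hJi.sdiff (finite_singleton q)).nonempty
  have hlim : Filter.Tendsto (fun n : ℕ => ρ {y | ⟪(f n : E3), y⟫ = 1 - 2 / τ ^ 2})
      Filter.atTop (nhds (ρ ∅)) := by
    refine tendsto_measure_of_ae_tendsto_indicator_of_isFiniteMeasure Filter.atTop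
      MeasurableSet.empty ?_ ?_
    · intro n; exact (isClosed_eq (by fun_prop) continuous_const).measurableSet
    · filter_upwards [msupport_ae ρ] with y hy
      filter_upwards [hfin _ (hcon y hy)] with n hn
      simp only [mem_empty_iff_false, iff_false]
      intro h
      exact hn ⟨hJXX (f n).2, h⟩
  have hlim2 := (ENNReal.tendsto_toReal (measure_ne_top ρ _)).comp hlim
  have hlim3 : Filter.Tendsto (fun n => m * ‖x - f n‖) Filter.atTop (nhds (m * ‖x - q‖)) :=
    ((tendsto_const_nhds.sub hfq).norm).const_mul m
  have hle := le_of_tendsto_of_tendsto' hlim3 hlim2 (fun n => hm x hxJ (f n) (f n).2)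
  simp only [measure_empty, ENNReal.toReal_zero] at hle
  have : 0 < ‖x - q‖ := norm_pos_iff.2 (sub_ne_zero.2 hxq)
  nlinarith [mul_pos hm0 this]


lemma fin_y1 {k σ y0 y1 y2 : ℝ} (hk1 : |k| ≤ 1) (hσ : σ ≠ 0) (hy : y0 ^ 2 + y1 ^ 2 + y2 ^ 2 = 1)
    (hy1 : y1 ≠ 0) : ∃ ε > 0, ∀ h0 h1 h2 : ℝ, 0 < h0 ^ 2 + h1 ^ 2 + h2 ^ 2 →
      h0 ^ 2 + h1 ^ 2 + h2 ^ 2 < ε → |h0| ≤ 4 * (h0 ^ 2 + h1 ^ 2 + h2 ^ 2) →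
      k * h0 + σ * h2 = -(h0 ^ 2 + h1 ^ 2 + h2 ^ 2) / 2 → h0 * y0 + h1 * y1 + h2 * y2 = 0 → False := by
  have hs : 0 < |σ| := abs_pos.2 hσ
  set C := 4 + 5 / |σ| with hC
  have hC0 : 0 < C := by positivity
  have hb : 0 < y1 ^ 2 := by positivity
  refine ⟨y1 ^ 2 / (4 * C ^ 2), by positivity, fun h0 h1 h2 hQ0 hQε hh0 hkσ hperp => ?_⟩
  set Q := h0 ^ 2 + h1 ^ 2 + h2 ^ 2 with hQ
  have hh2 : |h2| ≤ 5 / |σ| * Q := by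
    rw [div_mul_eq_mul_div, le_div_iff₀ hs, ← abs_mul]
    have e : h2 * σ = -Q / 2 - k * h0 := by linarith
    have : |k * h0| ≤ 4 * Q := by
      rw [abs_mul]
      calc |k| * |h0| ≤ 1 * |h0| := mul_le_mul_of_nonneg_right hk1 (abs_nonneg _)
        _ ≤ 4 * Q := by linarith
    rw [e, abs_le]
    rw [abs_le] at this
    constructor <;> linarith [this.1, this.2]
  have hy0' : |y0| ≤ 1 := by rw [← sq_le_one_iff_abs_le_one]; nlinarith [sq_nonneg y1, sq_nonneg y2]
  have hy2' : |y2| ≤ 1 := by rw [← sq_le_one_iff_abs_le_one]; nlinarith [sq_nonneg y1, sq_nonneg y0]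
  have hsum : |h0| + |h2| ≤ C * Q := by rw [hC, add_mul]; linarith
  have h3 : |h1 * y1| ≤ C * Q := by
    have e : h1 * y1 = -(h0 * y0 + h2 * y2) := by linarith
    rw [e, abs_neg]
    refine (abs_add_le _ _).trans (le_trans ?_ hsum)
    rw [abs_mul, abs_mul]
    apply add_le_add
    · exact mul_le_of_le_one_right (abs_nonneg _) hy0'
    · exact mul_le_of_le_one_right (abs_nonneg _) hy2'
  have h4 : (h1 * y1) ^ 2 ≤ (C * Q) ^ 2 := sq_le_sq' (abs_le.1 h3).1 (abs_le.1 h3).2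
  have h5 : h0 ^ 2 + h2 ^ 2 ≤ (C * Q) ^ 2 := by
    rw [← sq_abs h0, ← sq_abs h2]
    have := pow_le_pow_left₀ (by positivity) hsum 2
    nlinarith [abs_nonneg h0, abs_nonneg h2, mul_nonneg (abs_nonneg h0) (abs_nonneg h2)]
  have hy11 : y1 ^ 2 ≤ 1 := by nlinarith [sq_nonneg y0, sq_nonneg y2]
  have h6 : y1 ^ 2 * (h0 ^ 2 + h2 ^ 2) ≤ (C * Q) ^ 2 := by
    calc y1 ^ 2 * (h0 ^ 2 + h2 ^ 2) ≤ 1 * (h0 ^ 2 + h2 ^ 2) :=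
          mul_le_mul_of_nonneg_right hy11 (by positivity)
      _ ≤ _ := by linarith
  have h7 : Q * y1 ^ 2 ≤ Q * (2 * C ^ 2 * Q) := by nlinarith
  have h8 := le_of_mul_le_mul_left h7 hQ0
  rw [lt_div_iff₀ (by positivity)] at hQε
  nlinarith

lemma fin_y {k σ y0 y2 h0 h2 Q : ℝ} (hkσ : k ^ 2 + σ ^ 2 = 1) (hσ : σ ≠ 0)
    (hy : y0 ^ 2 + y2 ^ 2 = 1) (hqy : k * y0 + σ * y2 = k) (hne : ¬ (y0 = 1 ∧ y2 = 0))
    (hh : k * h0 + σ * h2 = -Q / 2) (hperp : h0 * y0 + h2 * y2 = 0) : h0 = -k * Q := by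
  have hy01 : y0 ≠ 1 := by
    intro h
    apply hne
    refine ⟨h, ?_⟩
    rw [h] at hy
    have : y2 ^ 2 = 0 := by linarith
    exact pow_eq_zero_iff (two_ne_zero) |>.1 this
  have e1 : (1 - y0) * (σ ^ 2 * (1 + y0) - k ^ 2 * (1 - y0)) = 0 := by
    have : σ * y2 = k * (1 - y0) := by linarith
    have h2 : (σ * y2) ^ 2 = (k * (1 - y0)) ^ 2 := by rw [this]
    have h3 : y2 ^ 2 = 1 - y0 ^ 2 := by linarith
    rw [mul_pow, h3] at h2
    linarith
  have e2 : σ ^ 2 * (1 + y0) - k ^ 2 * (1 - y0) = 0 :=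
    (mul_eq_zero.1 e1).resolve_left (sub_ne_zero.2 hy01.symm)
  have e3 : y0 = 2 * k ^ 2 - 1 := by
    have : σ ^ 2 = 1 - k ^ 2 := by linarith
    rw [this] at e2; linarith
  have e4 : y2 = 2 * k * σ := by
    apply mul_left_cancel₀ hσ
    have : σ ^ 2 = 1 - k ^ 2 := by linarith
    rw [e3] at hqy
    linear_combination hqy - 2 * k * this
  rw [e3, e4] at hperp
  linear_combination 2 * k * hh - hperp

lemma mkE3_0 (a b c : ℝ) : mkE3 a b c 0 = a := rfl
lemma mkE3_1 (a b c : ℝ) : mkE3 a b c 1 = b := rfl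
lemma mkE3_2 (a b c : ℝ) : mkE3 a b c 2 = c := rfl

lemma cos_θmax {τ : ℝ} (hT : 6 < τ ^ 2) : Real.cos (θmax τ) = 1 - 2 / τ ^ 2 := by
  unfold θmax
  have := k_gt hT
  apply Real.cos_arccos
  · linarith
  · have : 0 ≤ 2 / τ ^ 2 := by positivity
    linarith

lemma sph_sum {x : E3} (hx : x ∈ Sphere2) : x 0 ^ 2 + x 1 ^ 2 + x 2 ^ 2 = 1 := by
  have : ⟪x, x⟫ = 1 := by rw [real_inner_self_eq_norm_sq, sph_norm hx]; norm_num
  rw [inner3] at this; linarith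

lemma sph_of_sum {x : E3} (hx : x 0 ^ 2 + x 1 ^ 2 + x 2 ^ 2 = 1) : x ∈ Sphere2 := by
  have : ⟪x, x⟫ = 1 := by rw [inner3]; linarith
  rw [real_inner_self_eq_norm_sq] at this
  simp only [Sphere2, mem_sphere_zero_iff_norm]
  nlinarith [norm_nonneg x]

lemma geo_far {q x : E3} (hq : q ∈ Sphere2) (hx : x ∈ Sphere2) {r : ℝ} (h0 : 0 ≤ r)
    (h : ¬ Real.arccos ⟪q, x⟫ < r) : r ≤ 2 * ‖x - q‖ := by
  push Not at h
  set θ := Real.arccos ⟪q, x⟫ with hθ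
  have h1 : Real.cos θ = ⟪q, x⟫ := Real.cos_arccos (sph_ge hq hx) (sph_le hq hx)
  have h2 : |θ| ≤ Real.pi := by
    rw [abs_of_nonneg (Real.arccos_nonneg _)]; exact Real.arccos_le_pi _
  have h3 := Real.cos_le_one_sub_mul_cos_sq h2
  have h4 := norm_sq_sph hx hq
  rw [real_inner_comm, ← h1] at h4
  have hpi := Real.pi_le_four
  have hpi0 := Real.pi_pos
  have h5 : 1 / 8 ≤ 2 / Real.pi ^ 2 := by
    rw [div_le_div_iff₀ (by norm_num) (by positivity)]; nlinarith
  have h6 : θ ^ 2 ≤ (2 * ‖x - q‖) ^ 2 := by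
    have := mul_le_mul_of_nonneg_right h5 (sq_nonneg θ)
    nlinarith
  have h7 := abs_le_of_sq_le_sq' h6 (by positivity)
  linarith [h7.2]

lemma q1_sph (τ : ℝ) : q1pt τ ∈ Sphere2 := by
  apply sph_of_sum
  simp only [q1pt, mkE3_0, mkE3_1, mkE3_2]
  have := Real.sin_sq_add_cos_sq (θmax τ)
  linarith

lemma q2_sph (τ : ℝ) : q2pt τ ∈ Sphere2 := by
  apply sph_of_sum
  simp only [q2pt, mkE3_0, mkE3_1, mkE3_2]
  have := Real.sin_sq_add_cos_sq (θmax τ)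
  nlinarith

lemma p_sph (s : ℝ) : pcurve s ∈ Sphere2 := by
  apply sph_of_sum
  simp only [pcurve, mkE3_0, mkE3_1, mkE3_2]
  have := Real.sin_sq_add_cos_sq s
  linarith

lemma p0_eq : pcurve 0 = mkE3 1 0 0 := by simp [pcurve]

/-- consequence of failure at scale `κ, s₁` -/
lemma fail_pt {τ : ℝ} (hT : 6 < τ ^ 2) {M : Set E3} (hM : M ⊆ Sphere2) {κ s s₁ : ℝ} (hκ : 0 ≤ κ)
    (hs : |s| ≤ s₁)
    (hne : Iset τ (κ * s₁) (mkE3 1 0 0) ∩ M ≠ Iset τ (κ * s₁) (pcurve s) ∩ M) :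
    ∃ x ∈ M, x ≠ q1pt τ ∧ x ≠ q2pt τ ∧ |x 0 - (1 - 2 / τ ^ 2)| ≤ s₁ ^ 2 / 2 + s₁ * |x 1| ∧
      κ * s₁ ≤ 2 * ‖x - q1pt τ‖ ∧ κ * s₁ ≤ 2 * ‖x - q2pt τ‖ := by
  have hs0 : 0 ≤ s₁ := (abs_nonneg s).trans hs
  have hk := k_gt hT
  set k := 1 - 2 / τ ^ 2 with hkdef
  have hp : mkE3 1 0 0 ∈ Sphere2 := p0_eq ▸ p_sph 0
  have hI : ∀ p ∈ Sphere2, ∀ x ∈ M, (x ∈ Iset τ (κ * s₁) p ∩ M ↔ k < ⟪p, x⟫ ∧ x ∉ Uset τ (κ * s₁)) := by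
    intro p hp x hx
    simp only [Iset, lightConeI, mem_inter_iff, mem_sdiff, Set.mem_ofPred_eq, hx, hM hx, and_true, true_and]
    rw [Dfun_pos_iff hT hp (hM hx)]
  have hx : ∃ x ∈ M, x ∉ Uset τ (κ * s₁) ∧ ((k < ⟪mkE3 1 0 0, x⟫ ∧ ⟪pcurve s, x⟫ ≤ k) ∨
      (k < ⟪pcurve s, x⟫ ∧ ⟪mkE3 1 0 0, x⟫ ≤ k)) := by
    by_contra hc
    push Not at hc
    apply hne
    ext x
    by_cases hxM : x ∈ M
    · rw [hI _ hp x hxM, hI _ (p_sph s) x hxM]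
      constructor
      · rintro ⟨h1, h2⟩; exact ⟨(hc x hxM h2).1 h1, h2⟩
      · rintro ⟨h1, h2⟩; exact ⟨(hc x hxM h2).2 h1, h2⟩
    · simp [hxM]
  obtain ⟨x, hxM, hxU, hx⟩ := hx
  have hxS := hM hxM
  simp only [inner3, pcurve, mkE3_0, mkE3_1, mkE3_2, one_mul, zero_mul, add_zero] at hx
  have hcs := Real.cos_le_one s
  have hx1 : x ≠ q1pt τ := by
    rintro rfl
    simp only [q1pt, mkE3_0, mkE3_1, cos_θmax hT, ← hkdef] at hx
    rcases hx with h | h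
    · linarith [h.1]
    · nlinarith [h.1]
  have hx2 : x ≠ q2pt τ := by
    rintro rfl
    simp only [q2pt, mkE3_0, mkE3_1, cos_θmax hT, ← hkdef] at hx
    rcases hx with h | h
    · linarith [h.1]
    · nlinarith [h.1]
  have hU : x ∉ geoBall (q1pt τ) (κ * s₁) ∧ x ∉ geoBall (q2pt τ) (κ * s₁) := by
    constructor
    · intro h; exact hxU ⟨Or.inl h, by simp [hx1, hx2]⟩
    · intro h; exact hxU ⟨Or.inr h, by simp [hx1, hx2]⟩
  refine ⟨x, hxM, hx1, hx2, ?_, ?_, ?_⟩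
  · have hd : |Real.cos s * x 0 + Real.sin s * x 1 - x 0| ≤ s₁ ^ 2 / 2 + s₁ * |x 1| := by
      have e : Real.cos s * x 0 + Real.sin s * x 1 - x 0 = -(1 - Real.cos s) * x 0 + Real.sin s * x 1 := by
        ring
      rw [e]
      refine (abs_add_le _ _).trans (add_le_add ?_ ?_)
      · rw [abs_mul, abs_neg, abs_of_nonneg (by linarith : 0 ≤ 1 - Real.cos s)]
        have h1 := Real.one_sub_sq_div_two_le_cos (x := s)
        have h2 : s ^ 2 ≤ s₁ ^ 2 := sq_le_sq' (by linarith [neg_abs_le s]) (by linarith [le_abs_self s])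
        have h3 : |x 0| ≤ 1 := by
          rw [← sq_le_one_iff_abs_le_one]
          nlinarith [sph_sum hxS, sq_nonneg (x 1), sq_nonneg (x 2)]
        calc (1 - Real.cos s) * |x 0| ≤ (1 - Real.cos s) * 1 :=
              mul_le_mul_of_nonneg_left h3 (by linarith)
          _ ≤ _ := by linarith
      · rw [abs_mul]
        exact mul_le_mul_of_nonneg_right (Real.abs_sin_le_abs.trans hs) (abs_nonneg _)
    rw [abs_le] at hd ⊢
    rcases hx with h | h <;> constructor <;> linarith [h.1, h.2, hd.1, hd.2]
  · exact geo_far (q1_sph τ) hxS (by positivity) fun h => hU.1 ⟨hxS, h⟩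
  · exact geo_far (q2_sph τ) hxS (by positivity) fun h => hU.2 ⟨hxS, h⟩


lemma main_aux {τ : ℝ} (hT : 6 < τ ^ 2) {ρ : Measure E3} {S : ℝ} (G : Good τ ρ S)
    (hMK : msupport ρ ∩ lightConeK τ (mkE3 1 0 0) ⊆ {q1pt τ, q2pt τ}) :
    ∃ κ s₀ : ℝ, 0 < κ ∧ 0 < s₀ ∧ ∀ s s₁ : ℝ, |s| ≤ s₁ → s₁ ≤ s₀ →
      Iset τ (κ * s₁) (mkE3 1 0 0) ∩ msupport ρ =
        Iset τ (κ * s₁) (pcurve s) ∩ msupport ρ := by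
  by_contra hcon
  push Not at hcon
  have hk := k_gt hT
  set k := 1 - 2 / τ ^ 2 with hkdef
  have hk1 : k < 1 := by
    have : 0 < 2 / τ ^ 2 := by positivity
    rw [hkdef]; linarith
  -- the sequence
  have hseq : ∀ n : ℕ, ∃ x ∈ msupport ρ, x ≠ q1pt τ ∧ x ≠ q2pt τ ∧
      |x 0 - k| ≤ 2 * (1 / ((n : ℝ) + 1)) ∧
      ∀ q ∈ ({q1pt τ, q2pt τ} : Set E3), |x 0 - k| ≤ 4 / ((n : ℝ) + 1) * ‖x - q‖ ^ 2 := by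
    intro n
    have hn : (0 : ℝ) < (n : ℝ) + 1 := by positivity
    obtain ⟨s, s₁, hs, hs₁, hne⟩ := hcon ((n : ℝ) + 1) (1 / ((n : ℝ) + 1)) hn (by positivity)
    obtain ⟨x, hxM, hx1, hx2, hx0, hq1, hq2⟩ := fail_pt hT G.sub hn.le hs hne
    have hs0 : 0 ≤ s₁ := (abs_nonneg s).trans hs
    have hxS := G.sub hxM
    refine ⟨x, hxM, hx1, hx2, ?_, ?_⟩
    · have h1 : 1 / ((n : ℝ) + 1) ≤ 1 := by
        rw [div_le_one hn]; have : (0 : ℝ) ≤ n := Nat.cast_nonneg n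
        linarith
      have h3 : |x 1| ≤ 1 := by
        rw [← sq_le_one_iff_abs_le_one]
        nlinarith [sph_sum hxS, sq_nonneg (x 0), sq_nonneg (x 2)]
      have h4 : s₁ * |x 1| ≤ s₁ := mul_le_of_le_one_right hs0 h3
      nlinarith
    · have gen : ∀ q : E3, q 1 = 0 → ((n : ℝ) + 1) * s₁ ≤ 2 * ‖x - q‖ →
          |x 0 - k| ≤ 4 / ((n : ℝ) + 1) * ‖x - q‖ ^ 2 := by
        intro q hq hle
        have hx1 : |x 1| ≤ ‖x - q‖ := by
          have := PiLp.norm_apply_le (x - q) 1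
          simpa [hq] using this
        set t := ‖x - q‖ with ht
        have ht0 : 0 ≤ t := norm_nonneg _
        have h5 : s₁ ≤ 2 * t / ((n : ℝ) + 1) := by rw [le_div_iff₀ hn]; linarith
        have h6 : s₁ ≤ 2 * t := by
          have : (0 : ℝ) ≤ n := Nat.cast_nonneg n
          nlinarith
        have h7 : s₁ ^ 2 / 2 + s₁ * |x 1| ≤ 2 * (s₁ * t) := by
          have := mul_le_mul_of_nonneg_left hx1 hs0
          nlinarith
        have h8 : s₁ * t ≤ 2 * t / ((n : ℝ) + 1) * t := mul_le_mul_of_nonneg_right h5 ht0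
        have h9 : 2 * (2 * t / ((n : ℝ) + 1) * t) = 4 / ((n : ℝ) + 1) * t ^ 2 := by ring
        linarith
      rintro q (rfl | rfl)
      · exact gen _ rfl hq1
      · exact gen _ rfl hq2
  choose x hxM hx1 hx2 hxk hxq using hseq
  have hcomp : IsCompact (msupport ρ) :=
    (isCompact_sphere (0 : E3) 1).of_isClosed_subset (msupport_closed ρ) G.sub
  obtain ⟨q, hqM, φ, hφ, hlim⟩ := hcomp.tendsto_subseq hxM
  have hcoord : ∀ i : Fin 3, Continuous (fun z : E3 => z i) := fun i => by fun_prop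
  have hq0 : q 0 = k := by
    have l1 : Filter.Tendsto (fun n => |x (φ n) 0 - k|) Filter.atTop (nhds |q 0 - k|) :=
      ((((hcoord 0).tendsto q).comp hlim).sub_const k).abs
    have l2 : Filter.Tendsto (fun n => 2 * (1 / ((φ n : ℝ) + 1))) Filter.atTop (nhds (2 * 0)) :=
      ((tendsto_one_div_add_atTop_nhds_zero_nat (𝕜 := ℝ)).comp hφ.tendsto_atTop).const_mul 2
    have := le_of_tendsto_of_tendsto' l1 l2 (fun n => hxk (φ n))
    rw [mul_zero] at this
    have h := abs_nonpos_iff.1 this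
    linarith
  have hqS := G.sub hqM
  have hqq : q ∈ ({q1pt τ, q2pt τ} : Set E3) := by
    apply hMK
    refine ⟨hqM, hqS, ?_⟩
    rw [inner3, cos_θmax hT]
    simp only [mkE3_0, mkE3_1, mkE3_2]
    rw [hq0]; ring
  have hq1 : q 1 = 0 := by rcases hqq with rfl | rfl <;> rfl
  have hsum := sph_sum hqS
  rw [hq0, hq1] at hsum
  set σ := q 2 with hσdef
  have hσ : σ ≠ 0 := by
    intro h; rw [h] at hsum; nlinarith
  set z : ℕ → E3 := fun n => x (φ n) with hz
  have hzq : ∀ n, z n ≠ q := by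
    intro n h
    rcases hqq with h2 | h2
    · exact hx1 _ (h.trans h2)
    · exact hx2 _ (h.trans h2)
  have hzk : ∀ n : ℕ, |z n 0 - k| ≤ 4 / ((n : ℝ) + 1) * ‖z n - q‖ ^ 2 := by
    intro n
    refine (hxq (φ n) q hqq).trans (mul_le_mul_of_nonneg_right ?_ (sq_nonneg _))
    have h1 : (n : ℝ) ≤ (φ n : ℝ) := by exact_mod_cast hφ.id_le n
    apply div_le_div_of_nonneg_left (by norm_num) (by positivity) (by linarith)
  have hlim' : Filter.Tendsto z Filter.atTop (nhds q) := hlim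
  -- apply claim R
  obtain ⟨y, hyM, hyinf⟩ := claimR hT G q (range z) (by rintro _ ⟨n, rfl⟩; exact hxM _) (by
      intro hfin
      have : q ∈ range z := hfin.isClosed.mem_of_tendsto hlim' (Filter.Eventually.of_forall fun n => ⟨n, rfl⟩)
      obtain ⟨n, hn⟩ := this
      exact hzq n hn) (by
      intro r hr
      obtain ⟨N, hN⟩ := Filter.eventually_atTop.1 (hlim'.eventually (Metric.ball_mem_nhds q hr))
      refine ((finite_Iio N).image z).subset ?_
      rintro _ ⟨⟨n, rfl⟩, hn⟩
      refine ⟨n, ?_, rfl⟩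
      by_contra hc
      exact hn (hN n (not_lt.1 hc)))
  have hyS := G.sub hyM
  have hfreq : ∀ N : ℕ, ∃ n ≥ N, ⟪z n, y⟫ = k := by
    intro N
    by_contra hc
    push Not at hc
    apply hyinf
    refine ((finite_Iio N).image z).subset ?_
    rintro _ ⟨⟨n, rfl⟩, hn⟩
    refine ⟨n, ?_, rfl⟩
    by_contra hc2
    exact hc n (not_lt.1 hc2) hn
  have hqy : ⟪q, y⟫ = k := by
    have hcl : IsClosed {w : E3 | ⟪w, y⟫ = k} := isClosed_eq (by fun_prop) continuous_const
    apply hcl.mem_of_frequently_of_tendsto (f := z) (b := Filter.atTop) _ hlim'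
    rw [Filter.frequently_atTop]
    exact hfreq
  -- coordinates
  have hQ : ∀ n, ‖z n - q‖ ^ 2 = (z n 0 - k) ^ 2 + (z n 1) ^ 2 + (z n 2 - σ) ^ 2 := by
    intro n
    rw [← real_inner_self_eq_norm_sq, inner3]
    simp only [PiLp.sub_apply, hq0, hq1, ← hσdef]
    ring
  have hQpos : ∀ n, 0 < ‖z n - q‖ ^ 2 := fun n => by
    have := norm_pos_iff.2 (sub_ne_zero.2 (hzq n))
    positivity
  have htan : ∀ n, k * (z n 0 - k) + σ * (z n 2 - σ) = -‖z n - q‖ ^ 2 / 2 := by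
    intro n
    rw [norm_sq_sph (G.sub (hxM _)) hqS, inner3, hq0, hq1]
    linear_combination -hsum
  have hperp : ∀ n, ⟪z n, y⟫ = k → (z n 0 - k) * y 0 + z n 1 * y 1 + (z n 2 - σ) * y 2 = 0 := by
    intro n hn
    rw [inner3] at hn hqy
    rw [hq0, hq1] at hqy
    linear_combination hn - hqy
  have hysum := sph_sum hyS
  have hy1 : y 1 = 0 := by
    by_contra hne
    obtain ⟨ε, hε, H⟩ := fin_y1 (k := k) (σ := σ) (by rw [abs_le]; constructor <;> linarith) hσ hysum hne
    have l : Filter.Tendsto (fun n => ‖z n - q‖ ^ 2) Filter.atTop (nhds 0) := by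
      have := ((hlim'.sub_const q).norm).pow 2
      simpa using this
    obtain ⟨N, hN⟩ := Filter.eventually_atTop.1 (l.eventually (gt_mem_nhds hε))
    obtain ⟨n, hn, hny⟩ := hfreq N
    refine H (z n 0 - k) (z n 1) (z n 2 - σ) ?_ ?_ ?_ ?_ (hperp n hny) <;> rw [← hQ]
    · exact hQpos n
    · exact hN n hn
    · refine (hzk n).trans (mul_le_mul_of_nonneg_right ?_ (sq_nonneg _))
      rw [div_le_iff₀ (by positivity)]
      have : (0 : ℝ) ≤ n := Nat.cast_nonneg n
      linarith
    · exact htan n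
  have hynp : ¬ (y 0 = 1 ∧ y 2 = 0) := by
    rintro ⟨h0, h2⟩
    obtain ⟨n, -, hn⟩ := hfreq 0
    have hmem : z n ∈ ({q1pt τ, q2pt τ} : Set E3) := by
      apply hMK
      refine ⟨hxM _, G.sub (hxM _), ?_⟩
      rw [inner3, h0, hy1, h2] at hn
      rw [inner3, cos_θmax hT]
      simp only [mkE3_0, mkE3_1, mkE3_2]
      linarith
    rcases hmem with h | h
    · exact hx1 _ h
    · exact hx2 _ h
  obtain ⟨n, hn, hny⟩ := hfreq 6
  have hp := hperp n hny
  rw [hy1, mul_zero, add_zero] at hp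
  rw [inner3, hq0, hq1, hy1] at hqy
  rw [hy1] at hysum
  have hfin := fin_y (by linarith) hσ (by linarith) (by linarith) hynp (htan n) hp
  have hb := hzk n
  rw [hfin, abs_mul, abs_neg, abs_of_nonneg (sq_nonneg ‖z n - q‖), abs_of_pos (by linarith : 0 < k)] at hb
  have hb2 := le_of_mul_le_mul_right hb (hQpos n)
  have hn6 : (6 : ℝ) ≤ n := by exact_mod_cast hn
  rw [le_div_iff₀ (by positivity)] at hb2
  nlinarith

/-- Lemma 7.3: in the non-osculating case, for `r(s) = κ s`, the
sets `I_{r(s₁)}(p) ∩ M` and `I_{r(s₁)}(p_s) ∩ M` coincide for `|s| ≤ s₁ ≤ s₀`. -/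
theorem stmt_13 (τ δ : ℝ) (hτ : Real.sqrt 6 < τ) (ρ : Measure E3) (hmin : IsMinimizer τ ρ)
    (hMK : msupport ρ ∩ lightConeK τ (mkE3 1 0 0) ⊆ {q1pt τ, q2pt τ})
    (V : Set E3) (hVopen : IsOpen V) (hq1V : q1pt τ ∈ V) (hq2V : q2pt τ ∈ V)
    (hδ : 0 < δ) (n : ℕ) (c : Fin n → ℝ → E3)
    (hsm : ∀ j, ∀ m : ℕ, ContDiffOn ℝ m (c j) (Set.Ioo (-δ) δ))
    (hmap : ∀ j, ∀ t ∈ Set.Ioo (-δ) δ, c j t ∈ Sphere2)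
    (harc : ∀ j, ∀ t ∈ Set.Ioo (-δ) δ, ‖deriv (c j) t‖ = 1)
    (h0 : ∀ j, c j 0 = q1pt τ ∨ c j 0 = q2pt τ)
    (hcover : (msupport ρ ∩ V) \ {q1pt τ, q2pt τ} ⊆ ⋃ j, c j '' Set.Ioo (-δ) δ)
    (hnonosc : ∀ j, deriv (fun t => ⟪mkE3 1 0 0, c j t⟫) 0 ≠ 0 ∨
        deriv (deriv fun t => ⟪mkE3 1 0 0, c j t⟫) 0 ≠ 0) :
    ∃ κ s₀ : ℝ, 0 < κ ∧ 0 < s₀ ∧ ∀ s s₁ : ℝ, |s| ≤ s₁ → s₁ ≤ s₀ →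
      Iset τ (κ * s₁) (mkE3 1 0 0) ∩ msupport ρ =
        Iset τ (κ * s₁) (pcurve s) ∩ msupport ρ := by
  have hT : 6 < τ ^ 2 := by
    have h1 : 0 ≤ Real.sqrt 6 := Real.sqrt_nonneg 6
    have h2 : Real.sqrt 6 ^ 2 = 6 := Real.sq_sqrt (by norm_num)
    nlinarith
  obtain ⟨S, G⟩ := good_of_min hmin
  exact main_aux hT G hMK
end

section
/- Let τ > √6, let p = (1,0,0), and for s ∈ ℝ set p_s = (cos s, sin s, 0). Then for every q = (q¹, q², q³) ∈ I(p): (i) the derivative satisfies |(d/ds) D(p_s, q)|_{s=0}| ≤ (τ² + 1)|q²|/2, and (ii) the second derivative satisfies (d²/ds²) D(p_s, q)|_{s=0} < 0. -/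
open MeasureTheory Set
open scoped RealInnerProductSpace ENNReal

lemma inner_mk (a b c : ℝ) (q : E3) : ⟪mkE3 a b c, q⟫ = a * q 0 + b * q 1 + c * q 2 := by
  simp [mkE3, PiLp.inner_apply, Fin.sum_univ_three, mul_comm]

/-- Lemma 7.4: derivative bounds for `D(p_s, q)` along the equator,
for `q` in the open light cone of `p = (1,0,0)`. -/
theorem stmt_14 (τ : ℝ) (hτ : Real.sqrt 6 < τ) (q : E3)
    (hq : q ∈ lightConeI τ (mkE3 1 0 0)) :
    |deriv (fun s => Dfun τ (pcurve s) q) 0| ≤ (τ ^ 2 + 1) * |q 1| / 2 ∧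
    deriv (deriv fun s => Dfun τ (pcurve s) q) 0 < 0 := by
  obtain ⟨hs, hD⟩ := hq
  have hn : q 0 ^ 2 + q 1 ^ 2 + q 2 ^ 2 = 1 := by
    have h1 : ‖q‖ = 1 := by simpa [Sphere2] using hs
    have h2 := EuclideanSpace.norm_sq_eq q
    rw [h1, Fin.sum_univ_three] at h2
    simp only [Real.norm_eq_abs, sq_abs] at h2
    linarith
  have hT : 6 < τ ^ 2 := (Real.sqrt_lt' (lt_of_le_of_lt (Real.sqrt_nonneg 6) hτ)).1 hτ
  unfold Dfun at hD
  rw [inner_mk] at hD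
  simp only [Dfun, pcurve, inner_mk]
  generalize q 0 = a at *
  generalize q 1 = b at *
  generalize q 2 = c at *
  generalize τ ^ 2 = T at *
  have ha1 : a ≤ 1 := by nlinarith [sq_nonneg b, sq_nonneg c]
  have ha2 : -1 ≤ a := by nlinarith [sq_nonneg b, sq_nonneg c]
  have hpos : 0 < 2 - T * (1 - a) := by
    by_contra hc
    push Not at hc
    nlinarith [mul_nonneg (by linarith : (0:ℝ) ≤ 1 + a) (by linarith : 0 ≤ -(2 - T * (1 - a)))]
  have hu : ∀ s : ℝ, HasDerivAt (fun s => Real.cos s * a + Real.sin s * b + 0 * c)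
      (-Real.sin s * a + Real.cos s * b) s := fun s =>
    (((Real.hasDerivAt_cos s).mul_const a).add ((Real.hasDerivAt_sin s).mul_const b)).add_const _
  have hv : ∀ s : ℝ, HasDerivAt (fun s => -Real.sin s * a + Real.cos s * b)
      (-Real.cos s * a + -Real.sin s * b) s := fun s =>
    (((Real.hasDerivAt_sin s).neg.mul_const a).add ((Real.hasDerivAt_cos s).mul_const b))
  have hd : deriv (fun s => 1 / 4 * (1 + (Real.cos s * a + Real.sin s * b + 0 * c)) *
      (2 - T * (1 - (Real.cos s * a + Real.sin s * b + 0 * c)))) = fun s =>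
      (1 + T * (Real.cos s * a + Real.sin s * b + 0 * c)) * 
        (-Real.sin s * a + Real.cos s * b) / 2 := by
    funext s
    have := (((hu s).const_add 1).const_mul (1/4)).mul ((((hu s).const_sub 1).const_mul T).const_sub 2)
    refine (HasDerivAt.deriv this).trans ?_
    ring
  rw [hd]
  constructor
  · simp only [Real.cos_zero, Real.sin_zero]
    rw [show (1 + T * (1 * a + 0 * b + 0 * c)) * (-0 * a + 1 * b) / 2 = (1 + T * a) * b / 2 by ring,
      abs_div, abs_mul, abs_two]
    gcongr
    rw [abs_le]
    constructor <;> nlinarith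
  · have h2 := ((((hu 0).const_mul T).const_add 1).mul (hv 0)).div_const 2
    refine lt_of_eq_of_lt (HasDerivAt.deriv h2) ?_
    simp only [Real.cos_zero, Real.sin_zero]
    have ha3 : 2 / 3 < a := by nlinarith
    have hb : T * b ^ 2 ≤ T * (1 - a ^ 2) := by
      apply mul_le_mul_of_nonneg_left _ (by linarith)
      nlinarith [sq_nonneg c]
    have key : T * (1 - 2 * a ^ 2) < a := by
      rcases le_or_gt (1 - 2 * a ^ 2) 0 with h | h
      · nlinarith
      · have hlt : a < 1 := by nlinarith
        have e1 : T * (1 - a) * (1 - 2 * a ^ 2) < 2 * (1 - 2 * a ^ 2) :=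
          mul_lt_mul_of_pos_right (by linarith) h
        have e2 : 2 * (1 - 2 * a ^ 2) ≤ a * (1 - a) := by nlinarith
        have e3 : (T * (1 - 2 * a ^ 2)) * (1 - a) < a * (1 - a) := by linarith
        exact lt_of_mul_lt_mul_right e3 (by linarith)
    linarith
end
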